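/- arXiv:1507.03195 — 2 statements merged into one kernel-verified Lean document; each statement's English description precedes it below -/
import Mathlib

section
/- For all positive integers d and k, there exists a cactus CT with girth at least k and cycle-distance at least d on which Bob has a winning strategy in the coloring game played with 4 colors; equivalently, χ_g(CT) ≥ 5. -/
namespace GCN

/-- The player whose turn it is. -/
inductive Player : Type
  | alice : Player
  | bob : Player

variable {V α : Type}

/-- A move consisting of coloring the uncolored vertex `v` with color `a` is legal in the
partial coloring `c` if `v` is uncolored and no neighbor of `v` has color `a`. -/
def legalMove (G : SimpleGraph V) (c : V → Option α) (v : V) (a : α) : Prop :=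
  c v = none ∧ ∀ u, G.Adj v u → c u ≠ some a

/-- The partial coloring obtained by coloring vertex `v` with color `a`. -/
def applyMove [DecidableEq V] (c : V → Option α) (v : V) (a : α) : V → Option α :=
  Function.update c v (some a)

/-- `BobWins G p c` : in the coloring game on `G` starting from the partial coloring `c` with
player `p` to move (the moving player must color an uncolored vertex properly whenever a legal
move exists; the game ends when no legal move exists), Bob has a strategy guaranteeing that the
game ends with some vertex uncolored. -/
inductive BobWins [DecidableEq V] (G : SimpleGraph V) : Player → (V → Option α) → Prop
  | endPos (p : Player) (c : V → Option α)
      (hend : ∀ v a, ¬ legalMove G c v a) (hunc : ∃ v, c v = none) : BobWins G p c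
  | aliceMove (c : V → Option α)
      (hmoves : ∃ v a, legalMove G c v a)
      (h : ∀ v a, legalMove G c v a → BobWins G .bob (applyMove c v a)) :
      BobWins G .alice c
  | bobMove (c : V → Option α) (v : V) (a : α)
      (hmove : legalMove G c v a)
      (h : BobWins G .alice (applyMove c v a)) : BobWins G .bob c

/-- `AliceWins G p c` : in the coloring game on `G` starting from the partial coloring `c` with
player `p` to move, Alice has a strategy guaranteeing that the game ends with all vertices
colored. -/
inductive AliceWins [DecidableEq V] (G : SimpleGraph V) : Player → (V → Option α) → Prop
  | endPos (p : Player) (c : V → Option α)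
      (hend : ∀ v a, ¬ legalMove G c v a) (hall : ∀ v, c v ≠ none) : AliceWins G p c
  | aliceMove (c : V → Option α) (v : V) (a : α)
      (hmove : legalMove G c v a)
      (h : AliceWins G .bob (applyMove c v a)) : AliceWins G .alice c
  | bobMove (c : V → Option α)
      (hmoves : ∃ v a, legalMove G c v a)
      (h : ∀ v a, legalMove G c v a → AliceWins G .alice (applyMove c v a)) :
      AliceWins G .bob c

/-- The game chromatic number of `G` : the least number `k` of colors such that Alice has a
winning strategy in the coloring game on `G` played with `k` colors (Alice moving first,
starting from the everywhere-uncolored position). -/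
noncomputable def gameChromaticNumber [DecidableEq V] (G : SimpleGraph V) : ℕ :=
  sInf {k : ℕ | AliceWins (α := Fin k) G .alice (fun _ => none)}

/-- `c` is a partial proper coloring of `G` : adjacent colored vertices get distinct colors. -/
def ProperPartial (G : SimpleGraph V) (c : V → Option α) : Prop :=
  ∀ ⦃u v : V⦄, G.Adj u v → ∀ a : α, c u = some a → c v ≠ some a

/-- `Phi G c v` : the set of colors appearing (under `c`) on the neighbors of `v`. -/
def Phi (G : SimpleGraph V) (c : V → Option α) (v : V) : Set α :=
  {a : α | ∃ u, G.Adj v u ∧ c u = some a}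

end GCN

namespace GCN

/-- A cactus is a graph in which every edge belongs to at most one cycle; equivalently, any two
cycles sharing an edge have the same edge set. -/
def IsCactus {V : Type} (G : SimpleGraph V) : Prop :=
  ∀ ⦃u v : V⦄ (c₁ : G.Walk u u) (c₂ : G.Walk v v), c₁.IsCycle → c₂.IsCycle →
    ∀ e : Sym2 V, e ∈ c₁.edges → e ∈ c₂.edges →
      ∀ e' : Sym2 V, e' ∈ c₁.edges ↔ e' ∈ c₂.edges

/-- The cycle-distance of a graph : the minimum length of a path whose two endpoints lie on
two different cycles (cycles being identified with their edge sets), as an `ℕ∞`. -/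
noncomputable def cycleDistance {V : Type} (G : SimpleGraph V) : ℕ∞ :=
  ⨅ (u : V) (v : V) (c₁ : G.Walk u u) (c₂ : G.Walk v v) (_ : c₁.IsCycle) (_ : c₂.IsCycle)
    (_ : ¬ ∀ e : Sym2 V, e ∈ c₁.edges ↔ e ∈ c₂.edges) (P : G.Walk u v) (_ : P.IsPath),
    (P.length : ℕ∞)

end GCN

namespace GCN

set_option linter.unusedSectionVars false

section Strategy

variable {K α : Type} [DecidableEq K] [DecidableEq α] [Fintype α]

/-- Record that color `a` has been put on a pendant vertex at `v`. -/
def leafColor (F : K → Finset α) (v : K) (a : α) : K → Finset α :=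
  Function.update F v (insert a (F v))

open Classical in
/-- Record that the core vertex `w` has been colored `e`. -/
noncomputable def coreColor (C : SimpleGraph K) (F : K → Finset α) (w : K) (e : α) :
    K → Finset α :=
  fun x => if C.Adj w x then insert e (F x) else F x

/-- The game on a core graph `C` with unlimited pendant vertices: `U` is the set of uncolored core
vertices and `F v` is a set of colors seen by `v`. `Forces C U F` says that Bob, to move, can
by coloring pendant vertices only make some uncolored vertex see all colors. -/
inductive Forces (C : SimpleGraph K) : Finset K → (K → Finset α) → Prop
  | dead (U : Finset K) (F : K → Finset α) (v : K) (hv : v ∈ U) (h : F v = Finset.univ) :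
      Forces C U F
  | move (U : Finset K) (F : K → Finset α) (v : K) (a : α) (hv : v ∈ U) (ha : a ∉ F v)
      (hpass : Forces C U (leafColor F v a))
      (hcol : ∀ w ∈ U, ∀ e ∉ leafColor F v a w,
        Forces C (U.erase w) (coreColor C (leafColor F v a) w e)) : Forces C U F

/-- The version of `Forces` with Alice to move; she may color a core vertex or pass. -/
def AliceTurn (C : SimpleGraph K) (U : Finset K) (F : K → Finset α) : Prop :=
  Forces C U F ∧ ∀ w ∈ U, ∀ e ∉ F w, Forces C (U.erase w) (coreColor C F w e)

variable {C : SimpleGraph K} {U : Finset K} {F : K → Finset α}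

lemma subset_leafColor (F : K → Finset α) (v : K) (a : α) (x : K) : F x ⊆ leafColor F v a x := by
  unfold leafColor
  by_cases h : x = v
  · subst h; simp
  · simp [h]

lemma leafColor_self (F : K → Finset α) (v : K) (a : α) : leafColor F v a v = insert a (F v) := by
  simp [leafColor]

lemma mem_leafColor (F : K → Finset α) (v : K) (a : α) : a ∈ leafColor F v a v := by
  simp [leafColor]

lemma subset_coreColor (C : SimpleGraph K) (F : K → Finset α) (w : K) (e : α) (x : K) :
    F x ⊆ coreColor C F w e x := by
  unfold coreColor
  split_ifs <;> simp

lemma mem_coreColor {w x : K} (h : C.Adj w x) (F : K → Finset α) (e : α) :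
    e ∈ coreColor C F w e x := by
  simp [coreColor, h]

lemma Forces.of_leaf {v : K} (hv : v ∈ U) (a : α) (h : AliceTurn C U (leafColor F v a)) :
    Forces C U F := by
  by_cases ha : a ∈ F v
  · have : leafColor F v a = F := by simp [leafColor, Finset.insert_eq_of_mem ha]
    rw [← this]; exact h.1
  · exact .move U F v a hv ha h.1 h.2

lemma Forces.of_card {v : K} (hv : v ∈ U) (h : Fintype.card α ≤ (F v).card + 1) :
    Forces C U F := by
  by_cases hu : F v = Finset.univ
  · exact .dead U F v hv hu
  obtain ⟨a, ha⟩ : ∃ a, a ∉ F v := by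
    by_contra! hc
    exact hu (Finset.eq_univ_iff_forall.2 hc)
  have hfull : leafColor F v a v = Finset.univ := by
    rw [leafColor_self]
    apply Finset.eq_univ_of_card
    rw [Finset.card_insert_of_notMem ha]
    have := Finset.card_le_univ (insert a (F v))
    rw [Finset.card_insert_of_notMem ha] at this
    omega
  refine .of_leaf hv a ⟨.dead _ _ v hv hfull, fun w hw e he => ?_⟩
  have hwv : v ≠ w := by
    rintro rfl
    simp [hfull] at he
  refine .dead _ _ v (Finset.mem_erase.2 ⟨hwv, hv⟩) ?_
  exact Finset.univ_subset_iff.1 (hfull ▸ subset_coreColor C _ w e v)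

/-- `p 0, …, p (m - 1)` is a path of uncolored core vertices. -/
structure PathIn (C : SimpleGraph K) (U : Finset K) (p : ℕ → K) (m : ℕ) : Prop where
  mem : ∀ i < m, p i ∈ U
  adj : ∀ i, i + 1 < m → C.Adj (p i) (p (i + 1))
  inj : ∀ i < m, ∀ j < m, p i = p j → i = j

lemma PathIn.erase {p : ℕ → K} {m : ℕ} (h : PathIn C U p m) {w : K} (hw : ∀ i < m, p i ≠ w) :
    PathIn C (U.erase w) p m :=
  ⟨fun i hi => Finset.mem_erase.2 ⟨hw i hi, h.mem i hi⟩, h.adj, h.inj⟩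

lemma PathIn.segment {p : ℕ → K} {m : ℕ} (h : PathIn C U p m) (s n : ℕ) (hn : s + n ≤ m) :
    PathIn C U (fun i => p (s + i)) n :=
  ⟨fun i hi => h.mem _ (by omega), fun i hi => h.adj (s + i) (by omega),
    fun i hi j hj e => by have := h.inj _ (by omega) _ (by omega) e; omega⟩

lemma PathIn.take {p : ℕ → K} {m : ℕ} (h : PathIn C U p m) {n : ℕ} (hn : n ≤ m) :
    PathIn C U p n :=
  ⟨fun i hi => h.mem _ (by omega), fun i hi => h.adj i (by omega),
    fun i hi j hj e => h.inj _ (by omega) _ (by omega) e⟩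

lemma PathIn.reverse {p : ℕ → K} {m : ℕ} (h : PathIn C U p m) :
    PathIn C U (fun i => p (m - 1 - i)) m := by
  refine ⟨fun i hi => h.mem _ (by omega), fun i hi => ?_, fun i hi j hj e => ?_⟩
  · have := h.adj (m - 1 - (i + 1)) (by omega)
    rw [show m - 1 - (i + 1) + 1 = m - 1 - i by omega] at this
    exact this.symm
  · have := h.inj _ (by omega) _ (by omega) e
    omega

/-- The part of a path below a removed vertex. -/
lemma PathIn.below {p : ℕ → K} {m : ℕ} (h : PathIn C U p m) {i : ℕ} (hi : i < m) :
    PathIn C (U.erase (p i)) p i :=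
  (h.take hi.le).erase fun j hj e => by have := h.inj j (by omega) i hi e; omega

/-- The segment of a path above a removed vertex. -/
lemma PathIn.above {p : ℕ → K} {m : ℕ} (h : PathIn C U p m) {i n : ℕ} (hi : i + 1 + n ≤ m) :
    PathIn C (U.erase (p i)) (fun j => p (i + 1 + j)) n :=
  (h.segment (i + 1) n hi).erase fun j hj e => by
    have := h.inj (i + 1 + j) (by omega) i (by omega) e; omega

/-- If one end of a path of `m` uncolored vertices sees a pair of colors and the other end sees a
color whose membership in the pair matches the parity of `m`, then Bob wins. -/
theorem Forces.of_path (m : ℕ) : ∀ (U : Finset K) (F : K → Finset (Fin 4)) (p : ℕ → K)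
    (P : Finset (Fin 4)) (c : Fin 4), PathIn C U p m → 0 < m → P.card = 2 → P ⊆ F (p 0) →
    c ∈ F (p (m - 1)) → (c ∈ P ↔ Even m) → Forces C U F := by
  induction m using Nat.strong_induction_on with
  | _ m ih =>
  intro U F p P c hp hm hP hPF hc hpar
  have three : ∀ (U : Finset K) (F : K → Finset (Fin 4)) (v : K) (f : Fin 4), v ∈ U → f ∉ P →
      insert f P ⊆ F v → Forces C U F := fun U F v f hv hf hs => by
    refine .of_card hv ?_
    have := Finset.card_le_card hs
    rw [Finset.card_insert_of_notMem hf, hP] at this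
    simpa using this
  rcases Nat.lt_or_ge m 2 with h1 | h2
  · obtain rfl : m = 1 := by omega
    refine three U F (p 0) c (hp.mem 0 (by omega)) (by simp [hpar]) ?_
    exact Finset.insert_subset hc hPF
  obtain ⟨Q, hQ, hcQ, hQe⟩ : ∃ Q : Finset (Fin 4), Q.card = 2 ∧ c ∈ Q ∧
      ∀ e, e ∈ Q ↔ (e ∈ P ↔ Even m) := by
    by_cases he : Even m
    · exact ⟨P, hP, by simpa [he] using hpar, by simp [he]⟩
    · refine ⟨Pᶜ, by simp [Finset.card_compl, hP], by simpa [he] using hpar, by simp [he]⟩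
  obtain ⟨c', hc'⟩ : ∃ c', Q = {c, c'} := by
    obtain ⟨x, y, -, rfl⟩ := Finset.card_eq_two.1 hQ
    rcases Finset.mem_insert.1 hcQ with rfl | h
    · exact ⟨y, rfl⟩
    · rw [Finset.mem_singleton] at h; subst h; exact ⟨x, Finset.pair_comm _ _⟩
  -- position with pairs at both ends
  have key : ∀ (F : K → Finset (Fin 4)), P ⊆ F (p 0) → Q ⊆ F (p (m - 1)) →
      ∀ w ∈ U, ∀ e ∉ F w, (∃ i < m, p i = w) → Forces C (U.erase w) (coreColor C F w e) := by
    rintro F hPF hQF w hw e he ⟨i, hi, rfl⟩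
    by_cases h : e ∈ P ↔ Even i
    · have hi0 : i ≠ 0 := by
        rintro rfl
        exact he (hPF (by simpa using h))
      refine ih i hi _ _ p P e (hp.below hi) (by omega) hP
        (hPF.trans (subset_coreColor ..)) (mem_coreColor ?_ _ _) h
      have := hp.adj (i - 1) (by omega)
      rw [show i - 1 + 1 = i by omega] at this
      exact this.symm
    · have hi1 : i ≠ m - 1 := by
        rintro rfl
        have hq : e ∉ Q := fun h' => he (hQF h')
        rw [hQe] at hq
        have : Even m ↔ ¬ Even (m - 1) := by
          obtain ⟨j, rfl⟩ : ∃ j, m = j + 1 := ⟨m - 1, by omega⟩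
          simp [Nat.even_add_one]
        tauto
      have hab := (hp.above (i := i) (n := m - 1 - i) (by omega)).reverse
      refine ih (m - 1 - i) (by omega) _ _ _ Q e hab (by omega) hQ ?_ (mem_coreColor ?_ _ _) ?_
      · rw [show i + 1 + (m - 1 - i - 1 - 0) = m - 1 by omega]
        exact hQF.trans (subset_coreColor ..)
      · rw [show i + 1 + (m - 1 - i - 1 - (m - 1 - i - 1)) = i + 1 by omega]
        exact hp.adj i (by omega)
      · have : (Even m ↔ (Even i ↔ ¬ Even (m - 1 - i))) := by
          obtain ⟨j, rfl⟩ : ∃ j, m = i + j + 1 := ⟨m - 1 - i, by omega⟩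
          rw [show i + j + 1 - 1 - i = j by omega, Nat.even_add_one, Nat.even_add]
          tauto
        rw [hQe]
        tauto
  have both : ∀ (U' : Finset K) (F : K → Finset (Fin 4)), PathIn C U' p m → P ⊆ F (p 0) →
      Q ⊆ F (p (m - 1)) → Forces C U' F := by
    intro U' F hp hPF hQF
    obtain ⟨f, hf⟩ : ∃ f, f ∉ P := by
      by_contra! hcon
      rw [Finset.eq_univ_iff_forall.2 hcon] at hP
      simp at hP
    have hins : insert f P ⊆ leafColor F (p 0) f (p 0) := by
      rw [leafColor_self]; exact Finset.insert_subset_insert _ hPF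
    refine .of_leaf (hp.mem 0 hm) f ⟨three _ _ (p 0) f (hp.mem 0 hm) hf hins, fun w hw e he => ?_⟩
    by_cases hw0 : w = p 0
    · subst hw0
      have hab := (hp.above (i := 0) (n := m - 1) (by omega)).reverse
      refine ih (m - 1) (by omega) _ _ _ Q e hab (by omega) hQ ?_ (mem_coreColor ?_ _ _) ?_
      · rw [show 0 + 1 + (m - 1 - 1 - 0) = m - 1 by omega]
        exact hQF.trans ((subset_leafColor ..).trans (subset_coreColor ..))
      · rw [show 0 + 1 + (m - 1 - 1 - (m - 1 - 1)) = 0 + 1 by omega]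
        exact hp.adj 0 (by omega)
      · have heP : e ∉ P := fun h => he (hins (Finset.mem_insert_of_mem h))
        have : Even m ↔ ¬ Even (m - 1) := by
          obtain ⟨j, rfl⟩ : ∃ j, m = j + 1 := ⟨m - 1, by omega⟩
          simp [Nat.even_add_one]
        rw [hQe]
        tauto
    · exact three _ _ (p 0) f (Finset.mem_erase.2 ⟨Ne.symm hw0, hp.mem 0 hm⟩) hf
        (hins.trans (subset_coreColor ..))
  have hPF' := hPF.trans (subset_leafColor F (p (m - 1)) c' (p 0))
  have hQF' : Q ⊆ leafColor F (p (m - 1)) c' (p (m - 1)) := by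
    rw [leafColor_self, hc', Finset.pair_comm]
    exact Finset.insert_subset_insert _ (by simpa using hc)
  refine .of_leaf (hp.mem (m - 1) (by omega)) c' ⟨both U _ hp hPF' hQF', fun w hw e he => ?_⟩
  by_cases hon : ∃ i < m, p i = w
  · exact key _ hPF' hQF' w hw e he hon
  · push Not at hon
    exact both _ _ (hp.erase hon) (hPF'.trans (subset_coreColor ..))
      (hQF'.trans (subset_coreColor ..))

/-- A path `z 0, …, z (k + r - 1)` of uncolored vertices with a chord from `z (k - 1)` to the last
vertex; the chord closes a cycle of length `r + 1`. -/
structure Lollipop (C : SimpleGraph K) (U : Finset K) (z : ℕ → K) (k r : ℕ) : Prop where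
  path : PathIn C U z (k + r)
  chord : C.Adj (z (k - 1)) (z (k + r - 1))
  stem_pos : 0 < k
  two_le : 2 ≤ r

/-- The vertices of a lollipop with the cycle traversed in the opposite direction. -/
def reflect (z : ℕ → K) (k r : ℕ) (i : ℕ) : K :=
  if i < k then z i else z (2 * k + r - 1 - i)

lemma Lollipop.path_reflect {z : ℕ → K} {k r : ℕ} (h : Lollipop C U z k r) :
    PathIn C U (reflect z k r) (k + r) := by
  have hk := h.stem_pos
  have hr := h.two_le
  refine ⟨fun i hi => ?_, fun i hi => ?_, fun i hi j hj e => ?_⟩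
  · unfold reflect
    split_ifs
    · exact h.path.mem _ (by omega)
    · exact h.path.mem _ (by omega)
  · unfold reflect
    split_ifs with h1 h2 h2
    · exact h.path.adj _ (by omega)
    · obtain rfl : i = k - 1 := by omega
      rw [show 2 * k + r - 1 - (k - 1 + 1) = k + r - 1 by omega]
      exact h.chord
    · omega
    · have := h.path.adj (2 * k + r - 1 - (i + 1)) (by omega)
      rw [show 2 * k + r - 1 - (i + 1) + 1 = 2 * k + r - 1 - i by omega] at this
      exact this.symm
  · unfold reflect at e
    split_ifs at e with h1 h2 h2 <;>
      · have := h.path.inj _ (by omega) _ (by omega) e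
        omega

lemma Lollipop.erase {z : ℕ → K} {k r : ℕ} (h : Lollipop C U z k r) {w : K}
    (hw : ∀ i < k + r, z i ≠ w) : Lollipop C (U.erase w) z k r :=
  ⟨h.path.erase hw, h.chord, h.stem_pos, h.two_le⟩

lemma exists_pair (g t : α) (k : ℕ) (h2 : 2 < Fintype.card α) (h : ¬ (g = t ∧ Even k)) :
    ∃ f, f ≠ g ∧ (t ∈ ({f, g} : Finset α) ↔ Odd k) := by
  by_cases hk : Even k
  · have : ∃ f, f ∉ ({g, t} : Finset α) := by
      by_contra! hc
      have h3 := Finset.card_le_two (a := g) (b := t)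
      rw [Finset.eq_univ_iff_forall.2 hc, Finset.card_univ] at h3
      omega
    obtain ⟨f, hf⟩ := this
    simp only [Finset.mem_insert, Finset.mem_singleton, not_or] at hf
    refine ⟨f, hf.1, ?_⟩
    have : ¬ Odd k := by simpa using hk
    simp only [Finset.mem_insert, Finset.mem_singleton]
    grind
  · have hodd : Odd k := by simpa using hk
    by_cases hgt : g = t
    · obtain ⟨f, hf⟩ : ∃ f, f ∉ ({g} : Finset α) := by
        by_contra! hc
        have h3 := Finset.card_singleton g
        rw [Finset.eq_univ_iff_forall.2 hc, Finset.card_univ] at h3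
        omega
      exact ⟨f, by simpa using hf, by simp [hgt, hodd]⟩
    · exact ⟨t, Ne.symm hgt, by simp [hodd]⟩

/-- On a lollipop with an odd cycle, a pair of colors seen at the start of the stem and a color
seen on the cycle next to the stem win for Bob with Alice to move, under a parity condition. -/
theorem AliceTurn.of_lollipop (k : ℕ) : ∀ (U : Finset K) (F : K → Finset (Fin 4)) (z : ℕ → K)
    (r : ℕ) (P : Finset (Fin 4)) (t : Fin 4), Lollipop C U z k r → Even r → P.card = 2 →
    P ⊆ F (z 0) → t ∈ F (z k) → (t ∈ P ↔ Odd k) → AliceTurn C U F := by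
  induction k using Nat.strong_induction_on with
  | _ k ih =>
  intro U F z r P t hz hr hP hPF ht hpar
  have hk := hz.stem_pos
  have hr2 := hz.two_le
  have off : ∀ (U : Finset K) (F : K → Finset (Fin 4)), Lollipop C U z k r → P ⊆ F (z 0) →
      t ∈ F (z k) → Forces C U F := fun U F hz hPF ht =>
    .of_path (k + 1) U F z P t (hz.path.take (by omega)) (by omega) hP hPF (by simpa using ht)
      (by rw [hpar, Nat.even_add_one, Nat.not_even_iff_odd])
  refine ⟨off U F hz hPF ht, fun w hw e he => ?_⟩
  have hPF' := hPF.trans (subset_coreColor C F w e (z 0))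
  have ht' := subset_coreColor C F w e _ ht
  by_cases hon : ∃ j < k + r, z j = w
  swap
  · push Not at hon
    exact off _ _ (hz.erase hon) hPF' ht'
  obtain ⟨j, hj, rfl⟩ := hon
  -- a path from the pair to the colored vertex, with the right parity
  have route : ∀ (q : ℕ → K) (i : ℕ), PathIn C U q (k + r) → q 0 = z 0 → q i = z j → i < k + r →
      (e ∈ P ↔ Even i) → Forces C (U.erase (z j)) (coreColor C F (z j) e) := by
    intro q i hq h0 hi hik hpar
    have hi0 : i ≠ 0 := by
      rintro rfl
      rw [← hi, h0] at he
      exact he (hPF (by simpa using hpar))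
    have hb := hq.below hik
    rw [hi] at hb
    refine .of_path i _ _ q P e hb (by omega) hP (h0 ▸ hPF') (mem_coreColor ?_ _ _) hpar
    have := hq.adj (i - 1) (by omega)
    rw [show i - 1 + 1 = i by omega, hi] at this
    exact this.symm
  by_cases hej : e ∈ P ↔ Even j
  · exact route z j hz.path rfl rfl hj hej
  rcases lt_trichotomy j (k - 1) with hjk | hjk | hjk
  · -- on the stem
    have hab := hz.path.above (i := j) (n := k - 1 - j + r) (by omega)
    have hz' : Lollipop C (U.erase (z j)) (fun i => z (j + 1 + i)) (k - 1 - j) r := by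
      refine ⟨hab, ?_, by omega, hr2⟩
      have := hz.chord
      rwa [show j + 1 + (k - 1 - j - 1) = k - 1 by omega,
        show j + 1 + (k - 1 - j + r - 1) = k + r - 1 by omega]
    have het : ¬ (e = t ∧ Even (k - 1 - j)) := by
      rintro ⟨rfl, h⟩
      obtain ⟨i, rfl⟩ : ∃ i, k = i + j + 1 := ⟨k - 1 - j, by omega⟩
      rw [show i + j + 1 - 1 - j = i by omega] at h
      rw [hpar, ← Nat.not_even_iff_odd, Nat.even_add_one, Nat.even_add] at hej
      tauto
    obtain ⟨f, hfe, hft⟩ := exists_pair e t (k - 1 - j) (by simp) het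
    refine .of_leaf (v := z (j + 1)) (hab.mem 0 (by omega)) f
      (ih (k - 1 - j) (by omega) _ _ _ r {f, e} t hz' hr (Finset.card_pair hfe) ?_ ?_ hft)
    · simp only [Nat.add_zero]
      rw [leafColor_self]
      refine Finset.insert_subset_insert _ ?_
      simpa using mem_coreColor (hz.path.adj j (by omega)) F e
    · rw [show j + 1 + (k - 1 - j) = k by omega]
      exact subset_leafColor _ _ _ _ ht'
  · -- the attachment vertex of the cycle
    have het : e ≠ t := by
      rintro rfl
      obtain ⟨i, rfl⟩ : ∃ i, k = i + 1 := ⟨k - 1, by omega⟩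
      rw [hpar, hjk, Nat.odd_add_one] at hej
      simp at hej
    have hab := hz.path.above (i := j) (n := r) (by omega)
    have hjk' : j + 1 = k := by omega
    refine .of_path r _ _ _ {t, e} e hab (by omega) (Finset.card_pair het.symm) ?_ ?_ (by simp [hr])
    · simp only [Nat.add_zero, hjk']
      refine Finset.insert_subset ht' ?_
      have := mem_coreColor (hz.path.adj j (by omega)) F e
      rw [hjk'] at this
      simpa using this
    · rw [show j + 1 + (r - 1) = k + r - 1 by omega]
      exact mem_coreColor (by rw [hjk]; exact hz.chord) _ _
  · -- elsewhere on the cycle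
    refine route (reflect z k r) (2 * k + r - 1 - j) hz.path_reflect (by simp [reflect, hk]) ?_
      (by omega) ?_
    · rw [reflect, if_neg (by omega)]
      congr 1
      omega
    · have h1 : Even (2 * k + r - 1 - j) ↔ ¬ Even j := by
        have h2 : Even (2 * k + r - 1 - j + 1 + j) := by
          rw [show 2 * k + r - 1 - j + 1 + j = 2 * k + r by omega]
          exact (even_two_mul k).add hr
        rw [Nat.even_add, Nat.even_add_one] at h2
        tauto
      tauto

end Strategy

section Hubs

variable {K α : Type} [Fintype K] [DecidableEq K] [DecidableEq α] [Fintype α]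
variable {C : SimpleGraph K} {U : Finset K} {F : K → Finset α}

lemma card_compl_erase_le (U : Finset K) (w : K) : (U.erase w)ᶜ.card ≤ Uᶜ.card + 1 := by
  rw [Finset.compl_erase]
  exact Finset.card_insert_le _ _

/-- Five lollipops with odd cycles, disjoint except for their common first vertex `v`. -/
structure IsFan (C : SimpleGraph K) (v : K) (z : Fin 5 → ℕ → K) (k r : ℕ) : Prop where
  start : ∀ s, z s 0 = v
  lollipop : ∀ s, Lollipop C Finset.univ (z s) k r
  even : Even r
  disjoint : ∀ s t i j, 0 < i → i < k + r → 0 < j → j < k + r → z s i = z t j → s = t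

/-- Bob wins if the uncolored vertex `v` sees two colors while few core vertices are colored. -/
def PairWins (C : SimpleGraph K) (α : Type) [DecidableEq α] [Fintype α] (v : K) : Prop :=
  ∀ (U : Finset K) (F : K → Finset α), Uᶜ.card ≤ 4 → v ∈ U → 1 < (F v).card → Forces C U F

lemma IsFan.pairWins {v : K} {z : Fin 5 → ℕ → K} {k r : ℕ} (h : IsFan C v z k r) (κ : ℕ)
    (hκ : κ ≤ 4) : PairWins C (Fin κ) v := by
  intro U F hU hv hF
  rcases hκ.lt_or_eq with h3 | rfl
  · exact .of_card hv (by simp only [Fintype.card_fin]; omega)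
  obtain ⟨P, hPF, hP⟩ := Finset.exists_subset_card_eq (Nat.succ_le_of_lt hF)
  obtain ⟨s, hs⟩ : ∃ s, ∀ i, 0 < i → i < k + r → z s i ∈ U := by
    by_contra! hcon
    choose f h0 hlt hf using hcon
    have : Fintype.card (Fin 5) ≤ Uᶜ.card := by
      refine Finset.card_le_card_of_injOn (fun s => z s (f s)) (fun s _ => by simpa using hf s)
        fun s _ t _ e => h.disjoint s t _ _ (h0 s) (hlt s) (h0 t) (hlt t) e
    simp at this
    omega
  have hz := h.lollipop s
  have hzU : Lollipop C U (z s) k r := by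
    refine ⟨⟨fun i hi => ?_, hz.path.adj, hz.path.inj⟩, hz.chord, hz.stem_pos, hz.two_le⟩
    rcases Nat.eq_zero_or_pos i with rfl | h0
    · rwa [h.start]
    · exact hs i h0 hi
  obtain ⟨t, ht⟩ : ∃ t, t ∈ P ↔ Odd k := by
    by_cases hk : Odd k
    · obtain ⟨t, ht⟩ := Finset.card_pos.1 (by omega : 0 < P.card)
      exact ⟨t, by simp [ht, hk]⟩
    · obtain ⟨t, ht⟩ := Finset.card_pos.1 (by simp [Finset.card_compl, hP] : 0 < Pᶜ.card)
      exact ⟨t, by simpa [hk] using ht⟩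
  refine .of_leaf (hzU.path.mem k (by have := hz.two_le; omega)) t
    (.of_lollipop k U _ (z s) r P t hzU h.even hP ?_ (mem_leafColor ..) ht)
  rw [h.start]
  exact hPF.trans (subset_leafColor ..)

lemma Forces.of_adj {A B : K} (hAB : C.Adj A B) (hA : PairWins C α A) (hB : PairWins C α B)
    (hU : Uᶜ.card ≤ 3) (hAU : A ∈ U) (hBU : B ∈ U) {x y : α} (hx : x ∈ F A) (hy : y ∈ F B)
    (hα : 2 ≤ Fintype.card α) : Forces C U F := by
  obtain ⟨f, hfx, hf⟩ : ∃ f, f ≠ x ∧ (x ≠ y → f = y) := by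
    by_cases h : x = y
    · have : Nontrivial α := Fintype.one_lt_card_iff_nontrivial.1 hα
      obtain ⟨f, hf⟩ := exists_ne x
      exact ⟨f, hf, by simp [h]⟩
    · exact ⟨y, Ne.symm h, by simp⟩
  have hpair : ({x, f} : Finset α) ⊆ leafColor F A f A :=
    Finset.insert_subset (subset_leafColor _ _ _ _ hx)
      (Finset.singleton_subset_iff.2 (mem_leafColor ..))
  have two : ∀ G : K → Finset α, leafColor F A f A ⊆ G A → 1 < (G A).card := fun G hG =>
    Finset.one_lt_card.2 ⟨x, hG (hpair (by simp)), f, hG (hpair (by simp)), hfx.symm⟩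
  refine .of_leaf hAU f ⟨hA U _ (by omega) hAU (two _ subset_rfl), fun w hw e he => ?_⟩
  have hc := card_compl_erase_le U w
  by_cases hwA : w = A
  · subst hwA
    refine hB _ _ (by omega) (Finset.mem_erase.2 ⟨hAB.ne', hBU⟩) (Finset.one_lt_card.2 ⟨y, ?_, e,
      mem_coreColor hAB _ _, ?_⟩)
    · exact subset_coreColor _ _ _ _ _ (subset_leafColor _ _ _ _ hy)
    · rintro rfl
      apply he
      by_cases h : x = y
      · exact h ▸ hpair (by simp)
      · exact hf h ▸ hpair (by simp)
  · exact hA _ _ (by omega) (Finset.mem_erase.2 ⟨Ne.symm hwA, hAU⟩) (two _ (subset_coreColor ..))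

lemma AliceTurn.of_adj {A B : K} (hAB : C.Adj A B) (hA : PairWins C α A) (hB : PairWins C α B)
    (hU : Uᶜ.card ≤ 2) (hAU : A ∈ U) (hBU : B ∈ U) {x : α} (hx : x ∈ F A) (hy : x ∈ F B)
    (hα : 2 ≤ Fintype.card α) : AliceTurn C U F := by
  refine ⟨.of_adj hAB hA hB (by omega) hAU hBU hx hy hα, fun w hw e he => ?_⟩
  have hc := card_compl_erase_le U w
  have hx' := subset_coreColor C F w e _ hx
  have hy' := subset_coreColor C F w e _ hy
  by_cases hwA : w = A
  · subst hwA
    exact hB _ _ (by omega) (Finset.mem_erase.2 ⟨hAB.ne', hBU⟩) (Finset.one_lt_card.2 ⟨x, hy', e,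
      mem_coreColor hAB _ _, fun h => he (h ▸ hx)⟩)
  by_cases hwB : w = B
  · subst hwB
    exact hA _ _ (by omega) (Finset.mem_erase.2 ⟨hAB.ne, hAU⟩) (Finset.one_lt_card.2 ⟨x, hx', e,
      mem_coreColor hAB.symm _ _, fun h => he (h ▸ hy)⟩)
  exact .of_adj hAB hA hB (by omega) (Finset.mem_erase.2 ⟨Ne.symm hwA, hAU⟩)
    (Finset.mem_erase.2 ⟨Ne.symm hwB, hBU⟩) hx' hy' hα

lemma Forces.of_hubs {p : ℕ → K} (hp : PathIn C U p 4) (hw : ∀ i < 4, PairWins C α (p i))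
    (hU : Uᶜ.card ≤ 1) (hα : 2 ≤ Fintype.card α) : Forces C U F := by
  obtain ⟨a⟩ : Nonempty α := Fintype.card_pos_iff.1 (by omega)
  have h01 := hp.adj 0 (by omega)
  have h12 := hp.adj 1 (by omega)
  have h23 := hp.adj 2 (by omega)
  -- color a pendant vertex at one more hub
  have finish : ∀ (U' : Finset K) (G : K → Finset α) (A B : K), C.Adj A B → PairWins C α A →
      PairWins C α B → U'ᶜ.card ≤ 2 → A ∈ U' → B ∈ U' → ∀ x, x ∈ G B → Forces C U' G :=
    fun U' G A B hAB hA hB hc hAU hBU x hx => .of_leaf hAU x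
      (.of_adj hAB hA hB hc hAU hBU (mem_leafColor ..) (subset_leafColor _ _ _ _ hx) hα)
  have h0 := hp.mem 0 (by omega)
  have h1 := hp.mem 1 (by omega)
  have h2 := hp.mem 2 (by omega)
  have h3 := hp.mem 3 (by omega)
  refine .of_leaf h1 a ⟨finish _ _ _ _ h12.symm (hw 2 (by omega)) (hw 1 (by omega)) (by omega) h2 h1
    a (mem_leafColor ..), fun w hwU e he => ?_⟩
  have hc := card_compl_erase_le U w
  have ha := subset_coreColor C _ w e _ (mem_leafColor F (p 1) a)
  have ne : ∀ i < 4, ∀ j < 4, i ≠ j → p i ≠ p j := fun i hi j hj hij e => hij (hp.inj i hi j hj e)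
  by_cases hw1 : w = p 1
  · subst hw1
    exact finish _ _ _ _ h23.symm (hw 3 (by omega)) (hw 2 (by omega)) (by omega)
      (Finset.mem_erase.2 ⟨ne 3 (by omega) 1 (by omega) (by omega), h3⟩)
      (Finset.mem_erase.2 ⟨ne 2 (by omega) 1 (by omega) (by omega), h2⟩) e (mem_coreColor h12 _ _)
  have h1' := Finset.mem_erase.2 ⟨Ne.symm hw1, h1⟩
  by_cases hw2 : w = p 2
  · subst hw2
    exact finish _ _ _ _ h01 (hw 0 (by omega)) (hw 1 (by omega)) (by omega)
      (Finset.mem_erase.2 ⟨ne 0 (by omega) 2 (by omega) (by omega), h0⟩) h1' a ha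
  · exact finish _ _ _ _ h12.symm (hw 2 (by omega)) (hw 1 (by omega)) (by omega)
      (Finset.mem_erase.2 ⟨Ne.symm hw2, h2⟩) h1' a ha

/-- Bob wins on a core graph with a path of eight hubs carrying fans. -/
theorem AliceTurn.of_fans {p : ℕ → K} {k r : ℕ} (hp : PathIn C Finset.univ p 8)
    (hfan : ∀ i < 8, ∃ z, IsFan C (p i) z k r) (κ : ℕ) (hκ : κ ≤ 4) (F : K → Finset (Fin κ)) :
    AliceTurn C Finset.univ F := by
  have hw : ∀ i < 8, PairWins C (Fin κ) (p i) := fun i hi => by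
    obtain ⟨z, hz⟩ := hfan i hi
    exact hz.pairWins κ hκ
  by_cases h2 : 2 ≤ Fintype.card (Fin κ)
  · refine ⟨.of_hubs (hp.take (n := 4) (by omega)) (fun i hi => hw i (by omega)) (by simp) h2,
      fun w _ e _ => ?_⟩
    have hc := card_compl_erase_le Finset.univ w
    rw [Finset.compl_univ, Finset.card_empty] at hc
    by_cases h : ∃ i < 4, p i = w
    · obtain ⟨i, hi, rfl⟩ := h
      exact .of_hubs ((hp.segment 4 4 (by omega)).erase fun j hj e => by
        have := hp.inj _ (by omega) _ (by omega) e; omega) (fun i hi => hw _ (by omega)) hc h2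
    · push Not at h
      exact .of_hubs ((hp.take (n := 4) (by omega)).erase h) (fun i hi => hw i (by omega)) hc h2
  · refine ⟨.of_card (hp.mem 0 (by omega)) (by omega), fun w _ e _ => ?_⟩
    by_cases h : w = p 0
    · exact .of_card (v := p 1) (Finset.mem_erase.2 ⟨fun h' => by
        have := hp.inj 1 (by omega) 0 (by omega) (h'.trans h); omega, Finset.mem_univ _⟩) (by omega)
    · exact .of_card (v := p 0) (Finset.mem_erase.2 ⟨Ne.symm h, Finset.mem_univ _⟩) (by omega)

end Hubs

section Game

variable {V α : Type} [Fintype V] [DecidableEq V] {G : SimpleGraph V}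

lemma card_uncolored_applyMove_lt {c : V → Option α} {v : V} (hv : c v = none) (a : α) :
    Fintype.card {x // applyMove c v a x = none} < Fintype.card {x // c x = none} := by
  refine Fintype.card_lt_of_injective_of_notMem
    (fun x => ⟨x.1, ?_⟩) (fun x y h => by simpa [Subtype.ext_iff] using h) (b := ⟨v, hv⟩) ?_
  · have := x.2
    by_cases h : x.1 = v
    · simp [applyMove, h] at this
    · simpa [applyMove, h] using this
  · rintro ⟨⟨x, hx⟩, h⟩
    obtain rfl : x = v := by simpa using h
    simp [applyMove] at hx

/-- An uncolored vertex all of whose colors are blocked stays uncolored. -/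
lemma BobWins.of_blocked (p : Player) (c : V → Option α) (v : V) (hv : c v = none)
    (hb : ∀ a, ∃ u, G.Adj v u ∧ c u = some a) : BobWins G p c := by
  induction h : Fintype.card {x // c x = none} using Nat.strong_induction_on generalizing p c with
  | _ n ih =>
  subst h
  have step : ∀ w a, legalMove G c w a → ∀ q, BobWins G q (applyMove c w a) := fun w a hm q => by
    have hwv : v ≠ w := by
      rintro rfl
      obtain ⟨u, hu, hc⟩ := hb a
      exact hm.2 u hu hc
    refine ih _ (card_uncolored_applyMove_lt hm.1 a) q _ (by simpa [applyMove, hwv] using hv)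
      (fun b => ?_) rfl
    obtain ⟨u, hu, hc⟩ := hb b
    refine ⟨u, hu, ?_⟩
    have huw : u ≠ w := by
      rintro rfl
      simp [hm.1] at hc
    simpa [applyMove, huw] using hc
  by_cases hm : ∃ w a, legalMove G c w a
  · cases p with
    | alice => exact .aliceMove c hm fun w a h => step w a h _
    | bob =>
      obtain ⟨w, a, h⟩ := hm
      exact .bobMove c w a h (step w a h _)
  · push Not at hm
    exact .endPos p c hm ⟨v, hv⟩

/-- Both players cannot have winning strategies. -/
lemma BobWins.not_aliceWins {p : Player} {c : V → Option α} (h : BobWins G p c) :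
    ¬ AliceWins G p c := by
  induction h with
  | endPos p c hend hunc =>
    intro ha
    obtain ⟨v, hv⟩ := hunc
    cases ha with
    | endPos _ _ _ hall => exact hall v hv
    | aliceMove _ w a hm _ => exact hend w a hm
    | bobMove _ hm _ =>
      obtain ⟨w, a, hm⟩ := hm
      exact hend w a hm
  | aliceMove c hm _ ih =>
    intro ha
    cases ha with
    | endPos _ _ hend _ =>
      obtain ⟨w, a, hm⟩ := hm
      exact hend w a hm
    | aliceMove _ w a hm h => exact ih w a hm h
  | bobMove c w a hm _ ih =>
    intro ha
    cases ha with
    | endPos _ _ hend _ => exact hend w a hm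
    | bobMove _ _ h => exact ih (h w a hm)

/-- With more colors than vertices Alice wins. -/
lemma AliceWins.of_card_lt [Fintype α] (h : Fintype.card V < Fintype.card α) (p : Player)
    (c : V → Option α) : AliceWins G p c := by
  classical
  induction hn : Fintype.card {x // c x = none} using Nat.strong_induction_on generalizing p c with
  | _ n ih =>
  subst hn
  have step : ∀ w a, legalMove G c w a → ∀ q, AliceWins G q (applyMove c w a) := fun w a hm q =>
    ih _ (card_uncolored_applyMove_lt hm.1 a) q _ rfl
  by_cases hm : ∃ w a, legalMove G c w a
  · cases p with
    | bob => exact .bobMove c hm fun w a h => step w a h _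
    | alice =>
      obtain ⟨w, a, h⟩ := hm
      exact .aliceMove c w a h (step w a h _)
  · push Not at hm
    refine .endPos p c hm fun v hv => ?_
    obtain ⟨a, ha⟩ : ∃ a, some a ∉ Finset.univ.image c := by
      by_contra! hcon
      have h1 := Finset.card_le_card_of_injOn (s := (Finset.univ : Finset α)) some
        (fun a _ => hcon a) (Option.some_injective α).injOn
      have h2 := Finset.card_image_le (s := Finset.univ) (f := c)
      simp only [Finset.card_univ] at h1 h2
      omega
    exact hm v a ⟨hv, fun u _ hu => ha (Finset.mem_image.2 ⟨u, Finset.mem_univ _, hu⟩)⟩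

lemma lt_gameChromaticNumber (n : ℕ)
    (h : ∀ κ ≤ n, BobWins (α := Fin κ) G .alice fun _ => none) :
    n < gameChromaticNumber G := by
  have hne : {k : ℕ | AliceWins (α := Fin k) G .alice (fun _ => none)}.Nonempty :=
    ⟨Fintype.card V + 1, .of_card_lt (by simp) _ _⟩
  have := Nat.sInf_mem hne
  by_contra! hle
  exact (h _ hle).not_aliceWins this

end Game

section Transfer

variable {K α : Type} [Fintype K] [DecidableEq K] [DecidableEq α] [Fintype α] {M : ℕ}

/-- The graph obtained from `C` by attaching `M` pendant vertices to every vertex. -/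
def leafy (C : SimpleGraph K) (M : ℕ) : SimpleGraph (K × Option (Fin M)) where
  Adj p q := (p.2 = none ∧ q.2 = none ∧ C.Adj p.1 q.1) ∨ (p.1 = q.1 ∧ (p.2 = none ↔ q.2 ≠ none))
  symm := ⟨by
    rintro p q (⟨h1, h2, h3⟩ | ⟨h1, h2⟩)
    · exact .inl ⟨h2, h1, h3.symm⟩
    · exact .inr ⟨h1.symm, by tauto⟩⟩
  loopless := ⟨by
    rintro p (⟨-, -, h⟩ | ⟨-, h⟩)
    · exact C.loopless.irrefl _ h
    · tauto⟩

/-- A position on the leafy graph realizes the abstract position `(U, F)`. -/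
structure Realizes (C : SimpleGraph K) (c : K × Option (Fin M) → Option α) (U : Finset K)
    (F : K → Finset α) : Prop where
  uncolored : ∀ v, v ∈ U ↔ c (v, none) = none
  seen : ∀ v, ∀ a ∈ F v, ∃ u, (leafy C M).Adj (v, none) u ∧ c u = some a

/-- The number of colored vertices. -/
def numColored {W : Type} [Fintype W] (c : W → Option α) : ℕ :=
  (Finset.univ.filter fun x => c x ≠ none).card

lemma numColored_applyMove_le {W : Type} [Fintype W] [DecidableEq W] (c : W → Option α) (v : W)
    (a : α) : numColored (applyMove c v a) ≤ numColored c + 1 := by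
  unfold numColored
  refine (Finset.card_le_card (t := insert v (Finset.univ.filter fun x => c x ≠ none)) ?_).trans
    (Finset.card_insert_le _ _)
  intro x hx
  by_cases h : x = v
  · simp [h]
  · have hx' := (Finset.mem_filter.1 hx).2
    simpa [applyMove, h] using hx'

variable {C : SimpleGraph K} {U : Finset K} {F : K → Finset α}
  {c : K × Option (Fin M) → Option α}

lemma Realizes.exists_seen_applyMove (h : Realizes C c U F) {x : K × Option (Fin M)} {e : α}
    (hm : c x = none) {v : K} {a : α} (ha : a ∈ F v) :
    ∃ u, (leafy C M).Adj (v, none) u ∧ applyMove c x e u = some a := by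
  obtain ⟨u, hu, hc⟩ := h.seen v a ha
  refine ⟨u, hu, ?_⟩
  have hux : u ≠ x := by
    rintro rfl
    simp [hm] at hc
  simpa [applyMove, hux] using hc

lemma Realizes.pendant (h : Realizes C c U F) {w : K} {i : Fin M} (e : α)
    (hm : c (w, some i) = none) : Realizes C (applyMove c (w, some i) e) U F :=
  ⟨fun v => by rw [h.uncolored]; simp [applyMove], fun _ _ ha => h.exists_seen_applyMove hm ha⟩

lemma Realizes.leafColor (h : Realizes C c U F) {w : K} {i : Fin M} (e : α)
    (hm : c (w, some i) = none) :
    Realizes C (applyMove c (w, some i) e) U (leafColor F w e) := by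
  refine ⟨(h.pendant e hm).uncolored, fun v a ha => ?_⟩
  by_cases hF : a ∈ F v
  · exact h.exists_seen_applyMove hm hF
  · have hvw : v = w := by
      by_contra hne
      exact hF (by simpa [GCN.leafColor, hne] using ha)
    subst hvw
    obtain rfl : a = e := by simpa [leafColor_self, hF] using ha
    exact ⟨(v, some i), .inr ⟨rfl, by simp⟩, by simp [applyMove]⟩

lemma Realizes.coreColor (h : Realizes C c U F) {w : K} (e : α) (hm : c (w, none) = none) :
    Realizes C (applyMove c (w, none) e) (U.erase w) (coreColor C F w e) := by
  refine ⟨fun v => ?_, fun v a ha => ?_⟩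
  · rw [Finset.mem_erase, h.uncolored]
    by_cases hvw : v = w
    · simp [applyMove, hvw]
    · simp [applyMove, hvw]
  by_cases hF : a ∈ F v
  · exact h.exists_seen_applyMove hm hF
  · have hvw : C.Adj w v := by
      by_contra hne
      exact hF (by simpa [GCN.coreColor, hne] using ha)
    obtain rfl : a = e := by simpa [GCN.coreColor, hvw, hF] using ha
    exact ⟨(w, none), .inl ⟨rfl, rfl, hvw.symm⟩, by simp [applyMove]⟩

lemma Realizes.bobWins_alice {n : ℕ} (h : Realizes C c U F) (hU : U.Nonempty)
    (hn : numColored c ≤ n)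
    (hpass : ∀ c' : K × Option (Fin M) → Option α, Realizes C c' U F → numColored c' ≤ n + 1 →
      BobWins (leafy C M) .bob c')
    (hcol : ∀ w ∈ U, ∀ e ∉ F w, ∀ c' : K × Option (Fin M) → Option α,
      Realizes C c' (U.erase w) (GCN.coreColor C F w e) → numColored c' ≤ n + 1 →
        BobWins (leafy C M) .bob c') :
    BobWins (leafy C M) .alice c := by
  by_cases hm : ∃ x e, legalMove (leafy C M) c x e
  swap
  · push Not at hm
    obtain ⟨v, hv⟩ := hU
    exact .endPos _ c hm ⟨_, (h.uncolored v).1 hv⟩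
  refine .aliceMove c hm fun x e hx => ?_
  have hle := (numColored_applyMove_le c x e).trans (Nat.add_le_add_right hn 1)
  obtain ⟨w, _ | i⟩ := x
  · refine hcol w ((h.uncolored w).2 hx.1) e (fun he => ?_) _ (h.coreColor e hx.1) hle
    obtain ⟨u, hu, hc⟩ := h.seen w e he
    exact hx.2 u hu hc
  · exact hpass _ (h.pendant e hx.1) hle

/-- The number of colors not yet seen, summed over all core vertices. -/
def deficit (F : K → Finset α) : ℕ := ∑ v, (Fintype.card α - (F v).card)

lemma deficit_leafColor {v : K} {a : α} (ha : a ∉ F v) :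
    deficit (leafColor F v a) + 1 ≤ deficit F := by
  refine Nat.succ_le_of_lt (Finset.sum_lt_sum (fun x _ => ?_) ⟨v, Finset.mem_univ _, ?_⟩)
  · exact Nat.sub_le_sub_left (Finset.card_le_card (subset_leafColor ..)) _
  · have := Finset.card_le_univ (insert a (F v))
    rw [leafColor_self]
    rw [Finset.card_insert_of_notMem ha] at *
    omega

lemma deficit_coreColor_le (w : K) (e : α) : deficit (coreColor C F w e) ≤ deficit F :=
  Finset.sum_le_sum fun _ _ => Nat.sub_le_sub_left (Finset.card_le_card (subset_coreColor ..)) _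

theorem Forces.bobWins (hF : Forces C U F) : ∀ c : K × Option (Fin M) → Option α,
    Realizes C c U F → numColored c + 2 * deficit F ≤ M → BobWins (leafy C M) .bob c := by
  induction hF with
  | dead U F v hv hd =>
    intro c h _
    exact .of_blocked _ c _ ((h.uncolored v).1 hv) fun a => h.seen v a (hd ▸ Finset.mem_univ a)
  | move U F v a hv ha _ _ ihpass ihcol =>
    intro c h hM
    have hdef := deficit_leafColor ha
    obtain ⟨i, hi⟩ : ∃ i : Fin M, c (v, some i) = none := by
      by_contra! hcon
      have : (Finset.univ : Finset (Fin M)).card ≤ numColored c :=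
        Finset.card_le_card_of_injOn (fun i => (v, some i)) (fun i _ => by simpa using hcon i)
          fun i _ j _ hij => by simpa using hij
      simp at this
      omega
    have hvc := (h.uncolored v).1 hv
    refine .bobMove c (v, some i) a ⟨hi, fun u hu hc => ?_⟩ ?_
    · have : u = (v, none) := by
        rcases hu with ⟨h1, -⟩ | ⟨h1, h2⟩
        · simp at h1
        · exact Prod.ext h1.symm (by simpa using h2)
      rw [this, hvc] at hc
      simp at hc
    · refine (h.leafColor a hi).bobWins_alice ⟨v, hv⟩ (numColored_applyMove_le _ _ _)
        (fun c' hc' hle => ihpass c' hc' (by omega)) fun w hw e he c' hc' hle =>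
          ihcol w hw e he c' hc' ?_
      have := deficit_coreColor_le (C := C) (F := leafColor F v a) w e
      omega

/-- An abstract win with Alice to move is a win of the coloring game with enough pendants. -/
theorem AliceTurn.bobWins [Nonempty K] (h : AliceTurn C Finset.univ fun _ => (∅ : Finset α))
    (hM : 1 + 2 * (Fintype.card K * Fintype.card α) ≤ M) :
    BobWins (leafy C M) .alice fun _ => (none : Option α) := by
  have h0 : deficit (fun _ : K => (∅ : Finset α)) = Fintype.card K * Fintype.card α := by
    simp [deficit]
  have hr : Realizes (M := M) C (fun _ => none) Finset.univ fun _ => (∅ : Finset α) :=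
    ⟨by simp, by simp⟩
  refine hr.bobWins_alice Finset.univ_nonempty (n := 0) (by simp [numColored])
    (fun c' hc' hle => h.1.bobWins c' hc' (by omega)) fun w hw e he c' hc' hle =>
      (h.2 w hw e he).bobWins c' hc' ?_
  have := deficit_coreColor_le (C := C) (F := fun _ : K => (∅ : Finset α)) w e
  omega

end Transfer

section Cycles

variable {V B : Type} {G : SimpleGraph V}

open SimpleGraph

lemma exists_two_neighbors_of_isCycle {u : V} {c : G.Walk u u} (hc : c.IsCycle) {x : V}
    (hx : x ∈ c.support) : ∃ y z, y ≠ z ∧ ∀ w, s(x, w) ∈ c.edges ↔ w = y ∨ w = z := by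
  have h := hc.ncard_neighborSet_toSubgraph_eq_two hx
  obtain ⟨y, z, hyz, hs⟩ := Set.ncard_eq_two.1 h
  refine ⟨y, z, hyz, fun w => ?_⟩
  have : w ∈ c.toSubgraph.neighborSet x ↔ w ∈ ({y, z} : Set V) := by rw [hs]
  rw [← Walk.mem_edges_toSubgraph, Subgraph.mem_edgeSet]
  simpa using this

lemma iff_of_mem_support {S : V → Prop} {u v : V} (p : G.Walk u v)
    (h : ∀ x y, s(x, y) ∈ p.edges → S x → S y) : ∀ x ∈ p.support, S x ↔ S u := by
  induction p with
  | nil => simp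
  | cons ha p ih =>
    intro x hx
    rw [Walk.support_cons, List.mem_cons] at hx
    rcases hx with rfl | hx
    · rfl
    · rw [ih (fun x y hxy => h x y (by simp [hxy])) x hx]
      exact ⟨h _ _ (by simp [Sym2.eq_swap]), h _ _ (by simp)⟩

/-- A family of cycles `q b 0, …, q b r` containing all the cycles of `G`, certified by a rank
function: away from the last vertices of these cycles, at most one edge leads to a lower vertex. -/
structure CycleFamily (G : SimpleGraph V) (ρ : V → ℕ) (q : B → ℕ → V) (r : ℕ) : Prop where
  rank_ne : ∀ x y, G.Adj x y → ρ x ≠ ρ y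
  top : ∀ x y z, G.Adj x y → G.Adj x z → ρ y < ρ x → ρ z < ρ x → y ≠ z →
    ∃ b, x = q b r ∧ ∀ w, G.Adj x w → ρ w < ρ x → w = q b (r - 1) ∨ w = q b 0
  inner : ∀ b i y, 0 < i → i < r → G.Adj (q b i) y →
    y = q b (i - 1) ∨ y = q b (i + 1) ∨ ∀ z w, G.Adj y z → G.Adj y w → z = w
  inj : ∀ b i j, i ≤ r → j ≤ r → q b i = q b j → i = j
  two_le : 2 ≤ r

lemma CycleFamily.exists_edges {ρ : V → ℕ} {q : B → ℕ → V} {r : ℕ} (h : CycleFamily G ρ q r)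
    {u : V} {c : G.Walk u u} (hc : c.IsCycle) :
    ∃ b, (∀ x, x ∈ c.support ↔ ∃ i ≤ r, q b i = x) ∧
      ∀ e, e ∈ c.edges ↔ (∃ i < r, s(q b i, q b (i + 1)) = e) ∨ s(q b r, q b 0) = e := by
  have hr := h.two_le
  obtain ⟨v, hv, hmax⟩ : ∃ v ∈ c.support, ∀ x ∈ c.support, ρ x ≤ ρ v := by
    classical
    obtain ⟨v, hv, hm⟩ := c.support.toFinset.exists_max_image ρ ⟨u, by simp⟩
    exact ⟨v, by simpa using hv, by simpa using hm⟩
  have hlow : ∀ w, s(v, w) ∈ c.edges → G.Adj v w ∧ ρ w < ρ v := fun w hw =>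
    have ha := c.adj_of_mem_edges hw
    ⟨ha, lt_of_le_of_ne (hmax w (c.snd_mem_support_of_mem_edges hw)) (h.rank_ne _ _ ha).symm⟩
  obtain ⟨y, z, hyz, hvn⟩ := exists_two_neighbors_of_isCycle hc hv
  have hy := hlow y ((hvn y).2 (.inl rfl))
  have hz := hlow z ((hvn z).2 (.inr rfl))
  obtain ⟨b, rfl, hb⟩ := h.top v y z hy.1 hz.1 hy.2 hz.2 hyz
  have htop : ∀ w, s(q b r, w) ∈ c.edges ↔ w = q b (r - 1) ∨ w = q b 0 := by
    intro w
    rw [hvn]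
    have h1 := hb y hy.1 hy.2
    have h2 := hb z hz.1 hz.2
    grind
  have hin : ∀ i, 0 < i → i < r → q b i ∈ c.support →
      ∀ w, s(q b i, w) ∈ c.edges ↔ w = q b (i - 1) ∨ w = q b (i + 1) := by
    intro i h0 hi hs w
    obtain ⟨y, z, hyz, hn⟩ := exists_two_neighbors_of_isCycle hc hs
    have key : ∀ w, s(q b i, w) ∈ c.edges → w = q b (i - 1) ∨ w = q b (i + 1) := by
      intro w hw
      rcases h.inner b i w h0 hi (c.adj_of_mem_edges hw) with h1 | h1 | h1
      · exact .inl h1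
      · exact .inr h1
      · obtain ⟨y', z', hyz', hn'⟩ :=
          exists_two_neighbors_of_isCycle hc (c.snd_mem_support_of_mem_edges hw)
        exact absurd (h1 y' z' (c.adj_of_mem_edges ((hn' _).2 (.inl rfl)))
          (c.adj_of_mem_edges ((hn' _).2 (.inr rfl)))) hyz'
    have h1 := key y ((hn y).2 (.inl rfl))
    have h2 := key z ((hn z).2 (.inr rfl))
    rw [hn]
    grind
  have hmem : ∀ j ≤ r, q b (r - j) ∈ c.support := by
    intro j
    induction j with
    | zero => exact fun _ => hv
    | succ j ih =>
      intro hj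
      rcases Nat.eq_zero_or_pos j with rfl | h0
      · exact c.snd_mem_support_of_mem_edges ((htop _).2 (.inl rfl))
      · have := (hin (r - j) (by omega) (by omega) (ih (by omega)) _).2 (.inl rfl)
        exact c.snd_mem_support_of_mem_edges this
  have hmem' : ∀ i ≤ r, q b i ∈ c.support := fun i hi => by
    have := hmem (r - i) (by omega)
    rwa [show r - (r - i) = i by omega] at this
  have hstep : ∀ i < r, s(q b i, q b (i + 1)) ∈ c.edges := by
    intro i hi
    rw [Sym2.eq_swap]
    rcases Nat.lt_or_ge (i + 1) r with h1 | h1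
    · exact (hin (i + 1) (by omega) h1 (hmem' _ (by omega)) _).2 (.inl rfl)
    · obtain rfl : r = i + 1 := by omega
      exact (htop _).2 (.inl rfl)
  have hclose : s(q b r, q b 0) ∈ c.edges := (htop _).2 (.inr rfl)
  have hbot : ∀ w, s(q b 0, w) ∈ c.edges ↔ w = q b 1 ∨ w = q b r := by
    intro w
    obtain ⟨y, z, hyz, hn⟩ := exists_two_neighbors_of_isCycle hc (hmem' 0 (by omega))
    have h1 := (hn _).1 (hstep 0 (by omega))
    have h2 := (hn (q b r)).1 (by rw [Sym2.eq_swap]; exact hclose)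
    have h3 : q b (0 + 1) ≠ q b r := fun e => by
      have := h.inj b _ _ (by omega) le_rfl e
      omega
    rw [hn]
    grind
  have hE : ∀ i ≤ r, ∀ w, s(q b i, w) ∈ c.edges → (∃ j ≤ r, q b j = w) ∧
      ((∃ j < r, s(q b j, q b (j + 1)) = s(q b i, w)) ∨ s(q b r, q b 0) = s(q b i, w)) := by
    intro i hi w hw
    rcases Nat.eq_zero_or_pos i with rfl | h0
    · rcases (hbot w).1 hw with rfl | rfl
      · exact ⟨⟨1, by omega, rfl⟩, .inl ⟨0, by omega, rfl⟩⟩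
      · exact ⟨⟨r, by omega, rfl⟩, .inr Sym2.eq_swap⟩
    have hprev : s(q b (i - 1), q b (i - 1 + 1)) = s(q b i, q b (i - 1)) := by
      rw [Nat.sub_add_cancel h0, Sym2.eq_swap]
    rcases hi.lt_or_eq with h1 | rfl
    · rcases (hin i h0 h1 (hmem' i hi) w).1 hw with rfl | rfl
      · exact ⟨⟨i - 1, by omega, rfl⟩, .inl ⟨i - 1, by omega, hprev⟩⟩
      · exact ⟨⟨i + 1, by omega, rfl⟩, .inl ⟨i, by omega, rfl⟩⟩
    · rcases (htop w).1 hw with rfl | rfl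
      · exact ⟨⟨i - 1, by omega, rfl⟩, .inl ⟨i - 1, by omega, hprev⟩⟩
      · exact ⟨⟨0, by omega, rfl⟩, .inr rfl⟩
  have hS := iff_of_mem_support (S := fun x => ∃ i ≤ r, q b i = x) c (by
    rintro _ y hxy ⟨i, hi, rfl⟩
    exact (hE i hi y hxy).1)
  have hsupp : ∀ x, x ∈ c.support ↔ ∃ i ≤ r, q b i = x := by
    refine fun x => ⟨fun hx => (hS x hx).2 ((hS _ hv).1 ⟨r, le_rfl, rfl⟩), ?_⟩
    rintro ⟨i, hi, rfl⟩
    exact hmem' i hi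
  refine ⟨b, hsupp, fun e => ⟨fun he => ?_, ?_⟩⟩
  · induction e with
    | h x y =>
      obtain ⟨i, hi, rfl⟩ := (hsupp x).1 (c.fst_mem_support_of_mem_edges he)
      exact (hE i hi y he).2
  · rintro (⟨i, hi, rfl⟩ | rfl)
    · exact hstep i hi
    · exact hclose

lemma CycleFamily.le_egirth {ρ : V → ℕ} {q : B → ℕ → V} {r : ℕ} (h : CycleFamily G ρ q r) :
    (r : ℕ∞) ≤ G.egirth := by
  classical
  rw [SimpleGraph.le_egirth]
  intro u c hc
  obtain ⟨b, hs, -⟩ := h.exists_edges hc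
  have h1 : (Finset.range (r + 1)).card ≤ c.support.toFinset.card := by
    refine Finset.card_le_card_of_injOn (q b) (fun i hi => ?_) fun i hi j hj e => ?_
    · simp only [Finset.coe_range, Set.mem_Iio] at hi
      simpa using (hs _).2 ⟨i, by omega, rfl⟩
    · simp only [Finset.coe_range, Set.mem_Iio] at hi hj
      exact h.inj b i j (by omega) (by omega) e
  have h2 := c.support.toFinset_card_le
  rw [Walk.length_support] at h2
  rw [Finset.card_range] at h1
  exact_mod_cast (by omega : r ≤ c.length)

lemma le_length_of_lipschitz {f : V → ℕ} (hf : ∀ x y, G.Adj x y → f x ≤ f y + 1) {u v : V}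
    (p : G.Walk u v) : f u ≤ f v + p.length := by
  induction p with
  | nil => simp
  | cons ha p ih =>
    have := hf _ _ ha
    rw [Walk.length_cons]
    omega

variable {ρ : V → ℕ} {q : B → ℕ → V} {r d : ℕ}

lemma CycleFamily.isCactus (h : CycleFamily G ρ q r)
    (hq : ∀ a b i j, i ≤ r → j ≤ r → q a i = q b j → a = b) : IsCactus G := by
  intro u v c₁ c₂ h₁ h₂ e he₁ he₂
  obtain ⟨a, hs₁, hE₁⟩ := h.exists_edges h₁
  obtain ⟨b, hs₂, hE₂⟩ := h.exists_edges h₂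
  induction e with
  | h x y =>
    obtain ⟨i, hi, hix⟩ := (hs₁ x).1 (c₁.fst_mem_support_of_mem_edges he₁)
    obtain ⟨j, hj, hjx⟩ := (hs₂ x).1 (c₂.fst_mem_support_of_mem_edges he₂)
    obtain rfl := hq a b i j hi hj (hix.trans hjx.symm)
    exact fun e' => (hE₁ e').trans (hE₂ e').symm

lemma CycleFamily.le_cycleDistance (h : CycleFamily G ρ q r)
    (hfar : ∀ b, ∃ f : V → ℕ, (∀ x y, G.Adj x y → f x ≤ f y + 1) ∧ (∀ i ≤ r, d ≤ f (q b i)) ∧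
      ∀ a ≠ b, ∀ i ≤ r, f (q a i) = 0) : (d : ℕ∞) ≤ cycleDistance G := by
  refine le_iInf fun u => le_iInf fun v => le_iInf fun c₁ => le_iInf fun c₂ => le_iInf fun h₁ =>
    le_iInf fun h₂ => le_iInf fun hne => le_iInf fun p => le_iInf fun _ => ?_
  obtain ⟨b, hs₁, hE₁⟩ := h.exists_edges h₁
  obtain ⟨a, hs₂, hE₂⟩ := h.exists_edges h₂
  have hab : a ≠ b := by
    rintro rfl
    exact hne fun e => (hE₁ e).trans (hE₂ e).symm
  obtain ⟨i, hi, hiu⟩ := (hs₁ u).1 c₁.start_mem_support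
  obtain ⟨j, hj, hjv⟩ := (hs₂ v).1 c₂.start_mem_support
  obtain ⟨f, hf, hf1, hf0⟩ := hfar b
  have h1 := le_length_of_lipschitz hf p
  have h2 := hf1 i hi
  have h3 := hf0 a hab j hj
  rw [hiu] at h2
  rw [hjv] at h3
  exact_mod_cast (by omega : d ≤ p.length)

end Cycles

section Construction

/-- A path of eight hubs, each carrying five branches with `d + r` vertices. -/
abbrev CoreVertex (d r : ℕ) : Type := Fin 8 ⊕ (Fin 8 × Fin 5 × Fin (d + r))

variable {d r : ℕ}

/-- The edges of the core graph, directed downwards. A branch is a path, with a chord from its last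
vertex to its `d`-th vertex. -/
def Below (d r : ℕ) : CoreVertex d r → CoreVertex d r → Prop
  | .inl i, .inl j => j.val + 1 = i.val
  | .inl _, .inr _ => False
  | .inr (i, _, n), .inl j => i = j ∧ n.val = 0
  | .inr (i, s, n), .inr (j, t, m) =>
    i = j ∧ s = t ∧ (m.val + 1 = n.val ∨ (m.val + 1 = d ∧ n.val + 1 = d + r))

/-- The core graph. -/
def coreGraph (d r : ℕ) : SimpleGraph (CoreVertex d r) := .fromRel (Below d r)

/-- Edges of the core graph join vertices of different heights. -/
def height : CoreVertex d r → ℕ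
  | .inl i => i
  | .inr (_, _, n) => 8 + n

lemma Below.height_lt (hr : 0 < r) {x y : CoreVertex d r} (h : Below d r x y) :
    height y < height x := by
  rcases x with i | ⟨i, s, n⟩ <;> rcases y with j | ⟨j, t, m⟩ <;>
    simp only [Below, height] at h ⊢ <;> omega

lemma coreGraph_adj (hr : 0 < r) {x y : CoreVertex d r} :
    (coreGraph d r).Adj x y ↔ Below d r x y ∨ Below d r y x := by
  rw [coreGraph, SimpleGraph.fromRel_adj, and_iff_right_of_imp]
  rintro (h | h) rfl <;> exact (h.height_lt hr).false

/-- The vertices of the lollipop formed by the hub `i` and its branch `s`. -/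
def branch (d r : ℕ) (i : Fin 8) (s : Fin 5) : ℕ → CoreVertex d r
  | 0 => .inl i
  | n + 1 => if h : n < d + r then .inr (i, s, ⟨n, h⟩) else .inl i

lemma branch_succ {i : Fin 8} {s : Fin 5} {n : ℕ} (h : n < d + r) :
    branch d r i s (n + 1) = .inr (i, s, ⟨n, h⟩) := dif_pos h

lemma isFan_branch (hd : 0 < d) (hr : 2 ≤ r) (he : Even r) (i : Fin 8) :
    IsFan (coreGraph d r) (.inl i) (branch d r i) (d + 1) r where
  start _ := rfl
  even := he
  lollipop s := by
    refine ⟨⟨fun _ _ => Finset.mem_univ _, fun n hn => ?_, fun n hn m hm e => ?_⟩, ?_, by omega, hr⟩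
    · rw [coreGraph_adj (by omega)]
      right
      rcases n with _ | n
      · rw [branch_succ (by omega)]
        exact ⟨rfl, rfl⟩
      · rw [branch_succ (by omega), branch_succ (by omega)]
        exact ⟨rfl, rfl, .inl rfl⟩
    · rcases n with _ | n <;> rcases m with _ | m
      · rfl
      · rw [branch_succ (by omega)] at e
        simp [branch] at e
      · rw [branch_succ (by omega)] at e
        simp [branch] at e
      · rw [branch_succ (by omega), branch_succ (by omega)] at e
        simpa using e
    · obtain ⟨d, rfl⟩ : ∃ m, d = m + 1 := ⟨d - 1, by omega⟩
      obtain ⟨r, rfl⟩ : ∃ m, r = m + 1 := ⟨r - 1, by omega⟩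
      rw [coreGraph_adj (by omega), show d + 1 + 1 + (r + 1) - 1 = d + 1 + r + 1 by omega,
        show d + 1 + 1 - 1 = d + 1 by omega, branch_succ (by omega), branch_succ (by omega)]
      exact .inr ⟨rfl, rfl, .inr ⟨rfl, rfl⟩⟩
  disjoint := by
    rintro s t (_ | n) (_ | m) h0 hn h0' hm e
    · omega
    · omega
    · omega
    · rw [branch_succ (by omega), branch_succ (by omega)] at e
      simp at e
      exact e.1

lemma pathIn_hubs (hr : 0 < r) :
    PathIn (coreGraph d r) Finset.univ (fun n => .inl (Fin.ofNat 8 n)) 8 where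
  mem _ _ := Finset.mem_univ _
  adj n hn := by
    rw [coreGraph_adj hr]
    right
    simp only [Below, Fin.ofNat]
    omega
  inj n hn m hm e := by
    simp only [Sum.inl.injEq, Fin.ofNat, Fin.mk.injEq] at e
    omega

theorem bobWins_coreGraph (hd : 0 < d) (hr : 2 ≤ r) (he : Even r) {M κ : ℕ} (hκ : κ ≤ 4)
    (hM : 1 + 2 * (Fintype.card (CoreVertex d r) * 4) ≤ M) :
    BobWins (leafy (coreGraph d r) M) .alice fun _ => (none : Option (Fin κ)) := by
  refine AliceTurn.bobWins (.of_fans (k := d + 1) (r := r) (pathIn_hubs (by omega))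
    (fun i _ => ⟨_, isFan_branch hd hr he _⟩) κ hκ _) (le_trans ?_ hM)
  have := Nat.mul_le_mul_left (Fintype.card (CoreVertex d r)) hκ
  rw [Fintype.card_fin]
  omega

/-- The cycle closed by the chord of a branch. -/
def branchCycle (d r M : ℕ) (b : Fin 8 × Fin 5) (i : ℕ) : CoreVertex d r × Option (Fin M) :=
  (branch d r b.1 b.2 (d + i), none)

lemma branchCycle_eq {M : ℕ} (hd : 0 < d) {b : Fin 8 × Fin 5} {i : ℕ} (hi : i ≤ r) :
    branchCycle d r M b i = (.inr (b.1, b.2, ⟨d - 1 + i, by omega⟩), none) := by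
  rw [branchCycle, ← branch_succ]
  congr 2
  omega

/-- The height, with pendant vertices on top. -/
def leafyHeight {M : ℕ} (x : CoreVertex d r × Option (Fin M)) : ℕ :=
  if x.2 = none then height x.1 else 8 + d + r

lemma height_lt (x : CoreVertex d r) : height x < 8 + d + r := by
  rcases x with i | ⟨i, s, n⟩ <;> simp only [height] <;> omega

lemma leafyHeight_none {M : ℕ} (x : CoreVertex d r) :
    leafyHeight (x, (none : Option (Fin M))) = height x := if_pos rfl

lemma height_lt_leafyHeight_some {M : ℕ} (x y : CoreVertex d r) (i : Fin M) :
    height x < leafyHeight (y, some i) := height_lt x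

lemma leafy_adj_none {K : Type} {C : SimpleGraph K} {M : ℕ} {x : K} {y : K × Option (Fin M)} :
    (leafy C M).Adj (x, none) y ↔ (y.2 = none ∧ C.Adj x y.1) ∨ (x = y.1 ∧ y.2 ≠ none) := by
  simp [leafy]

lemma leafy_adj_some {K : Type} {C : SimpleGraph K} {M : ℕ} {x : K} {i : Fin M}
    {y : K × Option (Fin M)} : (leafy C M).Adj (x, some i) y ↔ y = (x, none) := by
  simp only [leafy, Prod.ext_iff]
  simp
  tauto

/-- The cycles of the construction are the branch cycles. -/
lemma cycleFamily (hd : 0 < d) (hr : 2 ≤ r) (M : ℕ) :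
    CycleFamily (leafy (coreGraph d r) M) leafyHeight (branchCycle d r M) r := by
  have hr0 : 0 < r := by omega
  have low : ∀ x y : CoreVertex d r, ∀ o : Option (Fin M),
      (leafy (coreGraph d r) M).Adj (x, none) (y, o) →
      leafyHeight (y, o) < leafyHeight (x, (none : Option (Fin M))) → Below d r x y ∧ o = none := by
    intro x y o ha hlt
    rw [leafyHeight_none] at hlt
    rcases o with _ | i
    · rw [leafyHeight_none] at hlt
      rcases leafy_adj_none.1 ha with ⟨-, h⟩ | ⟨-, h⟩
      · exact ⟨((coreGraph_adj hr0).1 h).resolve_right fun h' => (h'.height_lt hr0).asymm hlt, rfl⟩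
      · exact absurd rfl h
    · exact absurd hlt (height_lt_leafyHeight_some x y i).asymm
  refine ⟨?_, ?_, ?_, ?_, hr⟩
  · rintro ⟨x, _ | i⟩ ⟨y, _ | j⟩ ha
    · rw [leafyHeight_none, leafyHeight_none]
      rcases leafy_adj_none.1 ha with ⟨-, h⟩ | ⟨-, h⟩
      · rcases (coreGraph_adj hr0).1 h with h | h
        · exact (h.height_lt hr0).ne'
        · exact (h.height_lt hr0).ne
      · exact absurd rfl h
    · rw [leafyHeight_none]
      exact (height_lt_leafyHeight_some x y j).ne
    · rw [leafyHeight_none]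
      exact (height_lt_leafyHeight_some y x i).ne'
    · simp [leafy_adj_some] at ha
  · rintro ⟨x, _ | i⟩ ⟨y, o⟩ ⟨z, o'⟩ hy hz hly hlz hyz
    swap
    · rw [leafy_adj_some] at hy hz
      exact absurd (hy.trans hz.symm) hyz
    obtain ⟨hby, rfl⟩ := low x y o hy hly
    obtain ⟨hbz, rfl⟩ := low x z o' hz hlz
    have hne : y ≠ z := fun e => hyz (by rw [e])
    obtain ⟨i, s, n, rfl, hn⟩ : ∃ i s, ∃ n : Fin (d + r), x = .inr (i, s, n) ∧ n.val + 1 = d + r := by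
      rcases x with i | ⟨i, s, n⟩
      · exfalso
        rcases y with j | ⟨j, t, m⟩ <;> rcases z with j' | ⟨j', t', m'⟩ <;>
          simp only [Below] at hby hbz
        apply hne
        congr 1
        omega
      · refine ⟨i, s, n, rfl, ?_⟩
        by_contra hcon
        apply hne
        rcases y with j | ⟨j, t, m⟩ <;> rcases z with j' | ⟨j', t', m'⟩ <;>
          simp only [Below] at hby hbz
        · rw [← hby.1, ← hbz.1]
        · omega
        · omega
        · obtain ⟨rfl, rfl, hm⟩ := hby
          obtain ⟨rfl, rfl, hm'⟩ := hbz
          congr 3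
          omega
    refine ⟨(i, s), ?_, ?_⟩
    · rw [branchCycle_eq hd le_rfl]
      congr 5
      exact Fin.ext (show n.val = d - 1 + r by omega)
    · rintro ⟨w, o⟩ hw hlw
      obtain ⟨hb, rfl⟩ := low _ w o hw hlw
      rw [branchCycle_eq hd (by omega), branchCycle_eq hd (by omega)]
      rcases w with j | ⟨j, t, m⟩ <;> simp only [Below] at hb
      · omega
      · obtain ⟨rfl, rfl, hm⟩ := hb
        simp only [Prod.mk.injEq, Sum.inr.injEq, true_and, and_true, Fin.ext_iff]
        omega
  · rintro ⟨i, s⟩ n ⟨y, o⟩ h0 hn ha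
    rw [branchCycle_eq hd hn.le] at ha
    rw [branchCycle_eq hd (by omega), branchCycle_eq hd (by omega)]
    rcases leafy_adj_none.1 ha with ⟨h1, h2⟩ | ⟨h1, h2⟩
    · obtain rfl : o = none := h1
      rcases y with j | ⟨j, t, m⟩
      · rcases (coreGraph_adj hr0).1 h2 with h | h <;> simp only [Below] at h
        omega
      · have : i = j ∧ s = t := by
          rcases (coreGraph_adj hr0).1 h2 with h | h <;> simp only [Below] at h <;> grind
        obtain ⟨rfl, rfl⟩ := this
        simp only [Prod.mk.injEq, Sum.inr.injEq, true_and, and_true, Fin.ext_iff]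
        rcases (coreGraph_adj hr0).1 h2 with h | h <;> simp only [Below] at h <;> omega
    · right; right
      obtain ⟨j, rfl⟩ := Option.ne_none_iff_exists'.1 h2
      intro z w hz hw
      exact (leafy_adj_some.1 hz).trans (leafy_adj_some.1 hw).symm
  · intro b i j hi hj e
    rw [branchCycle_eq hd hi, branchCycle_eq hd hj] at e
    simpa using e

/-- A function measuring how far up a given branch a vertex is. -/
def climb {M : ℕ} (b : Fin 8 × Fin 5) : CoreVertex d r × Option (Fin M) → ℕ
  | (.inl _, _) => 0
  | (.inr (i, s, n), _) => if (i, s) = b then min (n + 1) d else 0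

lemma climb_le_of_below {M : ℕ} (b : Fin 8 × Fin 5) {x y : CoreVertex d r} (h : Below d r x y)
    (o o' : Option (Fin M)) : climb b (x, o) ≤ climb b (y, o') + 1 ∧
      climb b (y, o') ≤ climb b (x, o) + 1 := by
  rcases x with i | ⟨i, s, n⟩ <;> rcases y with j | ⟨j, t, m⟩ <;> simp only [Below] at h <;>
    simp only [climb]
  · omega
  · split_ifs <;> omega
  · obtain ⟨rfl, rfl, h⟩ := h
    split_ifs <;> omega

lemma climb_le {M : ℕ} (hr : 0 < r) (b : Fin 8 × Fin 5) (x y : CoreVertex d r × Option (Fin M))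
    (h : (leafy (coreGraph d r) M).Adj x y) : climb b x ≤ climb b y + 1 := by
  obtain ⟨x, o⟩ := x
  obtain ⟨y, o'⟩ := y
  rcases h with ⟨-, -, h⟩ | ⟨h, -⟩
  · rcases (coreGraph_adj hr).1 h with h | h
    · exact (climb_le_of_below b h o o').1
    · exact (climb_le_of_below b h o' o).2
  · obtain rfl : x = y := h
    have : climb b (x, o) = climb b (x, o') := by
      rcases x with i | ⟨i, s, n⟩ <;> rfl
    omega

end Construction

end GCN

open GCN in
/-- For all positive integers `d` and `k`, there exists a (finite) cactus `CT` with girth at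
least `k` and cycle-distance at least `d` on which Bob has a winning strategy in the coloring
game played with 4 colors (Alice moving first from the all-uncolored position); equivalently,
`χ_g(CT) ≥ 5`. -/
theorem statement1 (d k : ℕ) (hd : 0 < d) (hk : 0 < k) :
    ∃ (V : Type) (_ : Fintype V) (_ : DecidableEq V) (CT : SimpleGraph V),
      IsCactus CT ∧ (k : ℕ∞) ≤ CT.egirth ∧ (d : ℕ∞) ≤ cycleDistance CT ∧
        BobWins (α := Fin 4) CT .alice (fun _ => none) ∧
        5 ≤ gameChromaticNumber CT := by
  have hr : 2 ≤ 2 * k := by omega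
  have hfam := cycleFamily hd hr (1 + 2 * (Fintype.card (CoreVertex d (2 * k)) * 4))
  have hwin : ∀ κ ≤ 4, _ := fun κ hκ =>
    bobWins_coreGraph (r := 2 * k) (κ := κ) hd hr (even_two_mul k) hκ le_rfl
  refine ⟨_, inferInstance, inferInstance, leafy (coreGraph d (2 * k)) _, ?_, ?_, ?_,
    hwin 4 le_rfl, lt_gameChromaticNumber 4 hwin⟩
  · refine hfam.isCactus fun a b i j hi hj e => ?_
    rw [branchCycle_eq hd hi, branchCycle_eq hd hj] at e
    simp only [Prod.mk.injEq, Sum.inr.injEq] at e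
    exact Prod.ext e.1.1 e.1.2.1
  · exact le_trans (by exact_mod_cast (by omega : k ≤ 2 * k)) hfam.le_egirth
  · refine hfam.le_cycleDistance fun b => ⟨climb b, climb_le (by omega) b, fun i hi => ?_,
      fun a hab i hi => ?_⟩
    · rw [branchCycle_eq hd hi]
      simp only [climb, if_true]
      omega
    · rw [branchCycle_eq hd hi]
      exact if_neg hab
end

section
/- Winning cycle lemma: Let G be a finite simple graph, let C = {1,2,3,4} be a set of 4 colors, and consider a position (a partial proper coloring of G with colors from C) with Alice to move. Suppose G contains a cycle of odd length all of whose vertices are uncolored, each vertex of the cycle having at least 8 uncolored pendant neighbors, and suppose the cycle has two adjacent vertices u and v and two distinct colors a, b such that {a, b} ⊆ Φ(u) and a ∈ Φ(v). Then the position is winning for Bob. -/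
namespace GCN

variable {V α : Type}

/-- The uncolored vertices whose only neighbor is `v`. -/
def freeLeaves (G : SimpleGraph V) (c : V → Option α) (v : V) : Set V :=
  {w : V | G.Adj v w ∧ (∀ u, G.Adj w u → u = v) ∧ c w = none}

/-- The vertex `v` is uncolored and has at least `k` uncolored pendant neighbors. -/
structure Ready (G : SimpleGraph V) (c : V → Option α) (v : V) (k : ℕ) : Prop where
  uncolored : c v = none
  le_ncard : k ≤ (freeLeaves G c v).ncard

theorem Ready.mono {G : SimpleGraph V} {c : V → Option α} {v : V} {j k : ℕ}
    (h : Ready G c v k) (hjk : j ≤ k) : Ready G c v j :=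
  ⟨h.uncolored, hjk.trans h.le_ncard⟩

theorem Ready.notMem_freeLeaves {G : SimpleGraph V} {c : V → Option α} {v w : V}
    (h : Ready G c v 2) : v ∉ freeLeaves G c w := by
  intro hv
  have hsub : freeLeaves G c v ⊆ {w} := fun x hx => hv.2.1 x hx.1
  have := Set.ncard_le_ncard hsub
  have := h.le_ncard
  simp at *
  omega

variable [DecidableEq V]

theorem applyMove_self (c : V → Option α) (m : V) (d : α) : applyMove c m d m = some d := by
  simp [applyMove]

theorem applyMove_of_ne (c : V → Option α) {m v : V} (h : v ≠ m) (d : α) :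
    applyMove c m d v = c v := by
  simp [applyMove, h]

theorem Phi_subset_Phi_applyMove (G : SimpleGraph V) {c : V → Option α} {m : V}
    (hm : c m = none) (d : α) (v : V) : Phi G c v ⊆ Phi G (applyMove c m d) v := by
  rintro a ⟨u, hvu, hu⟩
  refine ⟨u, hvu, ?_⟩
  rwa [applyMove_of_ne]
  rintro rfl
  simp [hm] at hu

theorem mem_Phi_applyMove {G : SimpleGraph V} (c : V → Option α) {m v : V} (h : G.Adj v m)
    (d : α) : d ∈ Phi G (applyMove c m d) v :=
  ⟨m, h, applyMove_self c m d⟩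

omit [DecidableEq V] in
theorem legalMove.notMem_Phi {G : SimpleGraph V} {c : V → Option α} {m : V} {d : α}
    (h : legalMove G c m d) : d ∉ Phi G c m :=
  fun ⟨u, hu, hd⟩ => h.2 u hu hd

theorem freeLeaves_diff_subset (G : SimpleGraph V) (c : V → Option α) (m v : V) (d : α) :
    freeLeaves G c v \ {m} ⊆ freeLeaves G (applyMove c m d) v := by
  rintro w ⟨⟨h1, h2, h3⟩, hw⟩
  exact ⟨h1, h2, by rwa [applyMove_of_ne c hw]⟩

section Finite

variable [Finite V]

theorem Ready.applyMove_pred {G : SimpleGraph V} {c : V → Option α} {v m : V} {k : ℕ}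
    (h : Ready G c v (k + 1)) (hm : v ≠ m) (d : α) : Ready G (applyMove c m d) v k := by
  refine ⟨by rw [applyMove_of_ne c hm, h.uncolored], ?_⟩
  have h1 := Set.ncard_le_ncard (freeLeaves_diff_subset G c m v d)
  have h2 := Set.pred_ncard_le_ncard_sdiff_singleton (freeLeaves G c v) m
  have h3 := h.le_ncard
  omega

theorem Ready.applyMove {G : SimpleGraph V} {c : V → Option α} {v m : V} {k : ℕ}
    (h : Ready G c v k) (hm : v ≠ m) (hmv : m ∉ freeLeaves G c v) (d : α) :
    Ready G (applyMove c m d) v k := by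
  refine ⟨by rw [applyMove_of_ne c hm, h.uncolored], ?_⟩
  have h1 := Set.ncard_le_ncard (freeLeaves_diff_subset G c m v d)
  rw [Set.sdiff_singleton_eq_self hmv] at h1
  exact h.le_ncard.trans h1

/-- Coloring a free leaf of `v` leaves the free leaves of all other vertices untouched. -/
theorem Ready.applyMove_leaf {G : SimpleGraph V} {c : V → Option α} {v v' w : V} {k : ℕ}
    (h : Ready G c v' k) (hk : 2 ≤ k) (hw : w ∈ freeLeaves G c v) (hv : v' ≠ v) (d : α) :
    Ready G (GCN.applyMove c w d) v' k :=
  h.applyMove (fun e => (h.mono hk).notMem_freeLeaves (e ▸ hw))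
    (fun hw' => hv (hw.2.1 v' hw'.1.symm)) d

/-- Any color can be put on a free leaf of a ready vertex. -/
theorem Ready.exists_leaf {G : SimpleGraph V} {c : V → Option α} {v : V} {k : ℕ}
    (h : Ready G c v (k + 1)) (d : α) :
    ∃ w ∈ freeLeaves G c v, legalMove G c w d ∧ d ∈ Phi G (GCN.applyMove c w d) v ∧
      Ready G (GCN.applyMove c w d) v k := by
  have hne : (freeLeaves G c v).Nonempty := by
    rw [← Set.ncard_pos]
    have := h.le_ncard
    omega
  obtain ⟨w, hw⟩ := hne
  refine ⟨w, hw, ⟨hw.2.2, fun u hu => ?_⟩, mem_Phi_applyMove c hw.1 d,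
    h.applyMove_pred hw.1.ne d⟩
  rw [hw.2.1 u hu, h.uncolored]
  simp

/-- An uncolored vertex seeing all colors stays uncolored for ever. -/
theorem bobWins_of_Phi_eq_univ (G : SimpleGraph V) {v : V} (p : Player) (c : V → Option α)
    (hv : c v = none) (hPhi : ∀ d, d ∈ Phi G c v) : BobWins G p c := by
  induction hn : {x | c x = none}.ncard using Nat.strong_induction_on generalizing c p with
  | _ n ih =>
    have step : ∀ m d q, legalMove G c m d → BobWins G q (applyMove c m d) := by
      intro m d q hmd
      have hvm : v ≠ m := by
        rintro rfl
        exact hmd.notMem_Phi (hPhi d)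
      refine ih _ ?_ q (applyMove c m d) ((applyMove_of_ne c hvm d).trans hv)
        (fun a => Phi_subset_Phi_applyMove G hmd.1 d v (hPhi a)) rfl
      rw [← hn]
      refine Set.ncard_lt_ncard ⟨fun x hx => ?_, fun hsub => ?_⟩
      · by_cases hxm : x = m
        · simp [hxm, applyMove_self] at hx
        · simpa [applyMove_of_ne c hxm] using hx
      · simpa [applyMove_self] using hsub hmd.1
    by_cases hmoves : ∃ m d, legalMove G c m d
    · cases p with
      | alice => exact .aliceMove c hmoves fun m d h => step m d _ h
      | bob =>
        obtain ⟨m, d, h⟩ := hmoves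
        exact .bobMove c m d h (step m d _ h)
    · push Not at hmoves
      exact .endPos p c hmoves ⟨v, hv⟩

theorem bobWins_of_Phi_insert_eq_univ {G : SimpleGraph V} {v : V} {c : V → Option α}
    (hv : Ready G c v 1) (q : α) (hPhi : ∀ d, d ≠ q → d ∈ Phi G c v) : BobWins G .bob c := by
  obtain ⟨w, hw, hlegal, hq, hv'⟩ := hv.exists_leaf q
  refine .bobMove c w q hlegal (bobWins_of_Phi_eq_univ G _ _ hv'.uncolored fun d => ?_)
  by_cases hd : d = q
  · rwa [hd]
  · exact Phi_subset_Phi_applyMove G hw.2.2 q v (hPhi d hd)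

omit [Finite V] in
theorem bobWins_alice_of_forall {G : SimpleGraph V} {c : V → Option α} {v : V}
    (hv : c v = none) (h : ∀ m d, legalMove G c m d → BobWins G .bob (applyMove c m d)) :
    BobWins G .alice c := by
  by_cases hmoves : ∃ m d, legalMove G c m d
  · exact .aliceMove c hmoves h
  · push Not at hmoves
    exact .endPos _ c hmoves ⟨v, hv⟩

/-- `κ` splits the colors into two nonempty classes with at most two elements each. -/
structure IsPairing (κ : α → Bool) : Prop where
  exists_color : ∀ s, ∃ q, κ q = s
  exists_partner : ∀ q, ∃ q', ∀ d, κ d = κ q → d = q ∨ d = q'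

/-- The vertices `p l, …, p r` form an uncolored path with enough free leaves, and its two ends
see prescribed classes of colors, the labels `e i` alternating along the path: `p l` sees the class
`e l` and `p r` sees the class opposite to `e r`. -/
structure Trap (G : SimpleGraph V) (κ : α → Bool) (p : ℤ → V) (e : ℤ → Bool)
    (c : V → Option α) (l r : ℤ) : Prop where
  le : l ≤ r
  alternating : ∀ i, e (i + 1) = !e i
  adj : ∀ i, l ≤ i → i < r → G.Adj (p i) (p (i + 1))
  inj : ∀ i j, l ≤ i → i ≤ r → l ≤ j → j ≤ r → p i = p j → i = j
  inner : ∀ i, l < i → i < r → Ready G c (p i) 6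
  ends : l < r → Ready G c (p l) 4 ∧ Ready G c (p r) 4
  uncolored : c (p l) = none
  left : ∀ q, κ q = e l → q ∈ Phi G c (p l)
  right : ∀ q, κ q = !e r → q ∈ Phi G c (p r)

omit [DecidableEq V] [Finite V] in
theorem Trap.reverse {G : SimpleGraph V} {κ : α → Bool} {p : ℤ → V} {e : ℤ → Bool}
    {c : V → Option α} {l r : ℤ} (h : Trap G κ p e c l r) :
    Trap G κ (fun i => p (-i)) (fun i => !e (-i)) c (-r) (-l) where
  le := by have := h.le; omega
  alternating i := by
    have := h.alternating (-(i + 1))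
    simp only [neg_add_rev, neg_add_cancel_comm, Int.reduceNeg] at *
    simp [this]
  adj i h1 h2 := by
    have := h.adj (-(i + 1)) (by omega) (by omega)
    rw [show -(i + 1) + 1 = -i by ring] at this
    exact this.symm
  inj i j h1 h2 h3 h4 hij := by
    have := h.inj (-i) (-j) (by omega) (by omega) (by omega) (by omega) hij
    omega
  inner i h1 h2 := h.inner (-i) (by omega) (by omega)
  ends hlr := by simpa using (h.ends (by omega)).symm
  uncolored := by
    rcases h.le.eq_or_lt with hlr | hlr
    · simpa [← hlr] using h.uncolored
    · simpa using (h.ends hlr).2.uncolored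
  left := by simpa using h.right
  right := by simpa using h.left

/-- With the right end prepared, and one color of the required class seen by the left end, Bob
can complete the trap by coloring a leaf of the left end. -/
theorem bobWins_of_forall_trap {G : SimpleGraph V} {κ : α → Bool} (hκ : IsPairing κ)
    {p : ℤ → V} {e : ℤ → Bool} {c : V → Option α} {l r : ℤ} {q : α}
    (le : l ≤ r) (alternating : ∀ i, e (i + 1) = !e i)
    (adj : ∀ i, l ≤ i → i < r → G.Adj (p i) (p (i + 1)))
    (inj : ∀ i j, l ≤ i → i ≤ r → l ≤ j → j ≤ r → p i = p j → i = j)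
    (inner : ∀ i, l < i → i < r → Ready G c (p i) 6)
    (ready : Ready G c (p l) 1)
    (ends : l < r → Ready G c (p l) 5 ∧ Ready G c (p r) 4)
    (hq : κ q = e l) (left : q ∈ Phi G c (p l))
    (right : ∀ q, κ q = !e r → q ∈ Phi G c (p r))
    (ih : ∀ c', Trap G κ p e c' l r → BobWins G .alice c') : BobWins G .bob c := by
  obtain ⟨q', hq'⟩ := hκ.exists_partner q
  have key : ∃ k, Ready G c (p l) (k + 1) ∧ (l < r → 4 ≤ k) := by
    rcases le.eq_or_lt with hlr | hlr
    · exact ⟨0, ready, fun h => absurd hlr h.ne⟩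
    · exact ⟨4, (ends hlr).1, fun _ => le_rfl⟩
  obtain ⟨k, hk, hk4⟩ := key
  obtain ⟨w, hw, hlegal, hmem, hready⟩ := hk.exists_leaf q'
  refine .bobMove c w q' hlegal (ih _ ?_)
  exact
    { le, alternating, adj, inj
      inner := fun i h1 h2 => (inner i h1 h2).applyMove_leaf (by norm_num) hw
        (fun h => h1.ne (inj i l h1.le h2.le le_rfl le h).symm) q'
      ends := fun hlr => ⟨hready.mono (hk4 hlr), (ends hlr).2.applyMove_leaf (by norm_num) hw
        (fun h => hlr.ne (inj r l le le_rfl le_rfl le h).symm) q'⟩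
      uncolored := hready.uncolored
      left := fun d hd => by
        rcases hq' d (hd.trans hq.symm) with rfl | rfl
        · exact Phi_subset_Phi_applyMove G hw.2.2 q' _ left
        · exact hmem
      right := fun d hd => Phi_subset_Phi_applyMove G hw.2.2 q' _ (right d hd) }

/-- Bob can force Alice to color the left end of a trap, and so shorten it. -/
theorem bobWins_of_force_left {G : SimpleGraph V} {κ : α → Bool} (hκ : IsPairing κ)
    {p : ℤ → V} {e : ℤ → Bool} {c : V → Option α} {l r : ℤ}
    (hlr : l < r) (alternating : ∀ i, e (i + 1) = !e i)
    (adj : ∀ i, l ≤ i → i < r → G.Adj (p i) (p (i + 1)))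
    (inj : ∀ i j, l ≤ i → i ≤ r → l ≤ j → j ≤ r → p i = p j → i = j)
    (inner : ∀ i, l < i → i < r → Ready G c (p i) 6)
    (hl : Ready G c (p l) 3) (hr : Ready G c (p r) 4)
    (left : ∀ q, κ q = e l → q ∈ Phi G c (p l))
    (right : ∀ q, κ q = !e r → q ∈ Phi G c (p r))
    (ih : ∀ c', Trap G κ p e c' (l + 1) r → BobWins G .alice c') : BobWins G .bob c := by
  obtain ⟨q, hq⟩ := hκ.exists_color (!e l)
  obtain ⟨q', hq'⟩ := hκ.exists_partner q
  obtain ⟨w, hw, hlegal, hmem, hready⟩ := hl.exists_leaf q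
  have hsee : ∀ d, d ≠ q' → d ∈ Phi G (applyMove c w q) (p l) := by
    intro d hd
    by_cases hκd : κ d = e l
    · exact Phi_subset_Phi_applyMove G hw.2.2 q _ (left d hκd)
    · obtain rfl := (hq' d (by rw [hq]; exact Bool.eq_not.mpr hκd)).resolve_right hd
      exact hmem
  refine .bobMove c w q hlegal (bobWins_alice_of_forall hready.uncolored fun m d hmd => ?_)
  by_cases hm : p l = m
  · subst hm
    have hnot := hmd.notMem_Phi
    have hκd : κ d = e (l + 1) := by
      rw [alternating]
      by_contra hne
      exact hnot (Phi_subset_Phi_applyMove G hw.2.2 q _ (left d (by simpa using hne)))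
    have pres : ∀ i k, l < i → i ≤ r → 2 ≤ k → Ready G c (p i) k →
        Ready G (applyMove (applyMove c w q) (p l) d) (p i) k := by
      intro i k h1 h2 hk h
      have hne : p i ≠ p l := fun h => h1.ne (inj i l h1.le h2 le_rfl hlr.le h).symm
      exact (h.applyMove_leaf hk hw hne q).applyMove hne hready.notMem_freeLeaves d
    refine bobWins_of_forall_trap hκ (q := d) (by omega) alternating
      (fun i h1 h2 => adj i (by omega) h2)
      (fun i j h1 h2 h3 h4 => inj i j (by omega) h2 (by omega) h4)
      (fun i h1 h2 => pres i 6 (by omega) h2.le (by norm_num) (inner i (by omega) h2)) ?_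
      (fun h => ⟨(pres (l + 1) 6 (by omega) h.le (by norm_num)
        (inner (l + 1) (by omega) h)).mono (by norm_num),
        pres r 4 hlr le_rfl (by norm_num) hr⟩) hκd
      (mem_Phi_applyMove _ (adj l le_rfl hlr).symm d)
      (fun a ha => Phi_subset_Phi_applyMove G hmd.1 d _
        (Phi_subset_Phi_applyMove G hw.2.2 q _ (right a ha))) ih
    rcases (show l + 1 ≤ r by omega).eq_or_lt with h | h
    · rw [h]
      exact (pres r 4 hlr le_rfl (by norm_num) hr).mono (by norm_num)
    · exact (pres (l + 1) 6 (by omega) h.le (by norm_num)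
        (inner (l + 1) (by omega) h)).mono (by norm_num)
  · exact bobWins_of_Phi_insert_eq_univ (hready.applyMove_pred hm d) q'
      fun a ha => Phi_subset_Phi_applyMove G hmd.1 d _ (hsee a ha)

/-- Bob's answer to a move of Alice that helps the part of the trap to the right of `p i`. -/
theorem Trap.bobWins_applyMove {G : SimpleGraph V} {κ : α → Bool} (hκ : IsPairing κ)
    {p : ℤ → V} {e : ℤ → Bool} {c : V → Option α} {l r i : ℤ} (h : Trap G κ p e c l r)
    (hlr : l < r) {m : V} {d : α} (hmd : legalMove G c m d) (hli : l ≤ i) (hir : i ≤ r)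
    (him : (m = p i ∧ κ d = e (i + 1)) ∨ (m ∈ freeLeaves G c (p i) ∧ κ d = e i))
    (ih : ∀ c' j, l < j → Trap G κ p e c' j r → BobWins G .alice c') :
    BobWins G .bob (applyMove c m d) := by
  have ready : ∀ j, l ≤ j → j ≤ r → Ready G c (p j) 4 := by
    intro j h1 h2
    rcases h1.eq_or_lt with rfl | h1
    · exact (h.ends hlr).1
    rcases h2.eq_or_lt with rfl | h2
    · exact (h.ends hlr).2
    · exact (h.inner j h1 h2).mono (by norm_num)
  have right : ∀ a, κ a = !e r → a ∈ Phi G (applyMove c m d) (p r) := fun a ha =>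
    Phi_subset_Phi_applyMove G hmd.1 d _ (h.right a ha)
  have sees : m ∈ freeLeaves G c (p i) → d ∈ Phi G (applyMove c m d) (p i) := fun hm =>
    mem_Phi_applyMove c hm.1 d
  have pres : ∀ j k, i < j → j ≤ r → 2 ≤ k → Ready G c (p j) k →
      Ready G (applyMove c m d) (p j) k := by
    intro j k h1 h2 hk hj
    have hne : p j ≠ p i := fun he => h1.ne (h.inj j i (by omega) h2 hli hir he).symm
    rcases him with ⟨rfl, -⟩ | ⟨hm, -⟩
    · exact hj.applyMove hne ((ready i hli hir).mono (by norm_num)).notMem_freeLeaves d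
    · exact hj.applyMove_leaf hk hm hne d
  rcases him with ⟨rfl, hκd⟩ | ⟨hm, hκd⟩
  · have hir' : i < r := by
      refine lt_of_le_of_ne hir ?_
      rintro rfl
      exact hmd.notMem_Phi (h.right d (hκd.trans (h.alternating i)))
    refine bobWins_of_forall_trap hκ (q := d) (l := i + 1) (by omega) h.alternating
      (fun j h1 h2 => h.adj j (by omega) h2)
      (fun j j' h1 h2 h3 h4 => h.inj j j' (by omega) h2 (by omega) h4)
      (fun j h1 h2 => pres j 6 (by omega) h2.le (by norm_num) (h.inner j (by omega) h2))
      ((pres (i + 1) 4 (by omega) (by omega) (by norm_num)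
        (ready (i + 1) (by omega) (by omega))).mono (by norm_num))
      (fun h' => ⟨(pres (i + 1) 6 (by omega) (by omega) (by norm_num)
        (h.inner (i + 1) (by omega) h')).mono (by norm_num),
        pres r 4 (by omega) le_rfl (by norm_num) (ready r hlr.le le_rfl)⟩) hκd
      (mem_Phi_applyMove _ (h.adj i hli hir').symm d) right fun c' => ih c' (i + 1) (by omega)
  · rcases hli.eq_or_lt with rfl | hli'
    · exact bobWins_of_force_left hκ hlr h.alternating h.adj h.inj
        (fun j h1 h2 => pres j 6 h1 h2.le (by norm_num) (h.inner j h1 h2))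
        ((h.ends hlr).1.applyMove_pred hm.1.ne d)
        (pres r 4 hlr le_rfl (by norm_num) (h.ends hlr).2)
        (fun a ha => Phi_subset_Phi_applyMove G hmd.1 d _ (h.left a ha)) right
        fun c' => ih c' (l + 1) (by omega)
    · refine bobWins_of_forall_trap hκ (q := d) (l := i) hir h.alternating
        (fun j h1 h2 => h.adj j (by omega) h2)
        (fun j j' h1 h2 h3 h4 => h.inj j j' (by omega) h2 (by omega) h4)
        (fun j h1 h2 => pres j 6 (by omega) h2.le (by norm_num) (h.inner j (by omega) h2))
        (((ready i hli hir).mono (show 2 ≤ 4 by norm_num)).applyMove_pred hm.1.ne d)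
        (fun h' => ⟨(h.inner i hli' h').applyMove_pred hm.1.ne d,
          pres r 4 h' le_rfl (by norm_num) (ready r hlr.le le_rfl)⟩) hκd
        (sees hm) right fun c' => ih c' i hli'

theorem Trap.bobWins {G : SimpleGraph V} {κ : α → Bool} (hκ : IsPairing κ)
    {p : ℤ → V} {e : ℤ → Bool} {c : V → Option α} {l r : ℤ} (h : Trap G κ p e c l r) :
    BobWins G .alice c := by
  induction hn : (r - l).toNat using Nat.strong_induction_on generalizing p e c l r with
  | _ n ih =>
    rcases h.le.eq_or_lt with rfl | hlr
    · refine bobWins_of_Phi_eq_univ G _ c h.uncolored fun d => ?_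
      by_cases hd : κ d = e l
      · exact h.left d hd
      · exact h.right d (Bool.eq_not.mpr hd)
    refine bobWins_alice_of_forall h.uncolored fun m d hmd => ?_
    have answer_right : ∀ i, l ≤ i → i ≤ r →
        ((m = p i ∧ κ d = e (i + 1)) ∨ (m ∈ freeLeaves G c (p i) ∧ κ d = e i)) →
        BobWins G .bob (applyMove c m d) := fun i h1 h2 him =>
      h.bobWins_applyMove hκ hlr hmd h1 h2 him fun c' j hj h' => ih _ (by omega) h' rfl
    have answer_left : ∀ i, l ≤ i → i ≤ r →
        ((m = p i ∧ κ d = e i) ∨ (m ∈ freeLeaves G c (p i) ∧ κ d = !e i)) →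
        BobWins G .bob (applyMove c m d) := fun i h1 h2 him =>
      h.reverse.bobWins_applyMove hκ (i := -i) (by omega) hmd (by omega) (by omega)
        (by
          have hi := h.alternating (-1 + i)
          rw [neg_add_cancel_comm] at hi
          simpa [hi] using him)
        fun c' j hj h' => ih _ (by have := h'.le; omega) h' rfl
    by_cases hpath : ∃ i, l ≤ i ∧ i ≤ r ∧ m = p i
    · obtain ⟨i, h1, h2, hm⟩ := hpath
      by_cases hd : κ d = e i
      · exact answer_left i h1 h2 (.inl ⟨hm, hd⟩)
      · exact answer_right i h1 h2 (.inl ⟨hm, by rw [h.alternating]; exact Bool.eq_not.mpr hd⟩)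
    by_cases hleaf : ∃ i, l ≤ i ∧ i ≤ r ∧ m ∈ freeLeaves G c (p i)
    · obtain ⟨i, h1, h2, hm⟩ := hleaf
      by_cases hd : κ d = e i
      · exact answer_right i h1 h2 (.inr ⟨hm, hd⟩)
      · exact answer_left i h1 h2 (.inr ⟨hm, Bool.eq_not.mpr hd⟩)
    have pres : ∀ i k, l ≤ i → i ≤ r → Ready G c (p i) k →
        Ready G (applyMove c m d) (p i) k := fun i k h1 h2 hi =>
      hi.applyMove (fun he => hpath ⟨i, h1, h2, he.symm⟩) (fun hm => hleaf ⟨i, h1, h2, hm⟩) d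
    exact bobWins_of_force_left hκ hlr h.alternating h.adj h.inj
      (fun i h1 h2 => pres i 6 h1.le h2.le (h.inner i h1 h2))
      ((pres l 4 le_rfl hlr.le (h.ends hlr).1).mono (by norm_num))
      (pres r 4 hlr.le le_rfl (h.ends hlr).2)
      (fun a ha => Phi_subset_Phi_applyMove G hmd.1 d _ (h.left a ha))
      (fun a ha => Phi_subset_Phi_applyMove G hmd.1 d _ (h.right a ha))
      fun c' h' => ih _ (by omega) h' rfl

theorem isPairing_pair {a b : Fin 4} (hab : a ≠ b) :
    IsPairing (fun q : Fin 4 => decide (q = a ∨ q = b)) := by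
  constructor <;> decide +revert

/-- On an uncolored path with an even number of vertices, one end seeing two colors and the other
one of them, Bob wins if it is his turn. -/
theorem bobWins_of_even_path {G : SimpleGraph V} {c : V → Option (Fin 4)} {p : ℤ → V} {l r : ℤ}
    (hlr : l < r) (hodd : Odd (r - l)) (adj : ∀ i, G.Adj (p i) (p (i + 1)))
    (inj : ∀ i j, l ≤ i → i ≤ r → l ≤ j → j ≤ r → p i = p j → i = j)
    (ready : ∀ i, l ≤ i → i ≤ r → Ready G c (p i) 6) {a b : Fin 4} (hab : a ≠ b)
    (hl : a ∈ Phi G c (p l)) (ha : a ∈ Phi G c (p r)) (hb : b ∈ Phi G c (p r)) :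
    BobWins G .bob c := by
  refine bobWins_of_forall_trap (isPairing_pair hab) (p := p)
    (e := fun i => decide (Even (i - l))) (q := a) hlr.le (fun i => ?_) (fun i _ _ => adj i) inj
    (fun i h1 h2 => ready i h1.le h2.le) ((ready l le_rfl hlr.le).mono (by norm_num))
    (fun _ => ⟨(ready l le_rfl hlr.le).mono (by norm_num),
      (ready r hlr.le le_rfl).mono (by norm_num)⟩) (by simp) hl ?_
    fun c' h => h.bobWins (isPairing_pair hab)
  · rw [show i + 1 - l = i - l + 1 by ring]
    simp only [Int.even_add_one, decide_not]
  · intro q hq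
    have hne : ¬ Even (r - l) := Int.not_even_iff_odd.2 hodd
    simp only [hne, decide_false, Bool.not_false, decide_eq_true_eq] at hq
    rcases hq with rfl | rfl
    · exact ha
    · exact hb

end Finite

section Cycle

variable [Finite V]

/-- The winning cycle lemma for a cycle given as a periodic sequence of vertices. -/
theorem bobWins_of_periodic {G : SimpleGraph V} {c : V → Option (Fin 4)} {P : ℤ → V} {n : ℤ}
    (hn : Odd n) (hn3 : 3 ≤ n) (adj : ∀ i, G.Adj (P i) (P (i + 1)))
    (periodic : ∀ i j, P i = P j ↔ n ∣ i - j) (ready : ∀ i, Ready G c (P i) 8)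
    {a b : Fin 4} (hab : a ≠ b) (ha : a ∈ Phi G c (P 0)) (hb : b ∈ Phi G c (P 0))
    (ha' : a ∈ Phi G c (P 1)) : BobWins G .alice c := by
  have ne : ∀ i j, 0 < i - j → i - j < n → P i ≠ P j := fun i j h1 h2 h =>
    absurd (Int.le_of_dvd h1 ((periodic i j).1 h)) (by omega)
  have inj : ∀ l r, r - l < n → ∀ i j, l ≤ i → i ≤ r → l ≤ j → j ≤ r → P i = P j → i = j := by
    intro l r hlr i j h1 h2 h3 h4 hij
    rcases lt_trichotomy i j with h | h | h
    · exact absurd hij.symm (ne j i (by omega) (by omega))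
    · exact h
    · exact absurd hij (ne i j (by omega) (by omega))
  have inj_neg : ∀ l r, r - l < n → ∀ i j, l ≤ i → i ≤ r → l ≤ j → j ≤ r →
      P (-i) = P (-j) → i = j := by
    intro l r hlr i j h1 h2 h3 h4 hij
    have := inj (-r) (-l) (by omega) (-i) (-j) (by omega) (by omega) (by omega) (by omega) hij
    omega
  have adj_neg : ∀ i, G.Adj (P (-i)) (P (-(i + 1))) := by
    intro i
    have := adj (-(i + 1))
    rw [show -(i + 1) + 1 = -i by ring] at this
    exact this.symm
  have hPn : P n = P 0 := (periodic n 0).2 (by simp)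
  refine bobWins_alice_of_forall (ready 0).uncolored fun m d hmd => ?_
  have mono : ∀ v, Phi G c v ⊆ Phi G (applyMove c m d) v := Phi_subset_Phi_applyMove G hmd.1 d
  have pres : ∀ i k, k ≤ 7 → P i ≠ m → Ready G (applyMove c m d) (P i) k := fun i k hk h =>
    ((ready i).applyMove_pred (k := 7) h d).mono hk
  by_cases h0 : m = P 0
  · subst h0
    have had : a ≠ d := fun h => hmd.notMem_Phi (h ▸ ha)
    have ready' : ∀ i, -(n - 1) ≤ i → i ≤ -1 → Ready G (applyMove c (P 0) d) (P (-i)) 6 :=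
      fun i h1 h2 => pres (-i) 6 (by norm_num) (ne (-i) 0 (by omega) (by omega))
    refine bobWins_of_even_path (p := fun i => P (-i)) (l := -(n - 1)) (r := -1) (by omega) ?_
      adj_neg (inj_neg _ _ (by omega)) ready' had.symm ?_ ?_ (mono _ ha')
    · rw [show -1 - -(n - 1) = n - 2 by ring]
      exact hn.sub_even even_two
    · refine mem_Phi_applyMove c ?_ d
      have := adj (n - 1)
      rwa [sub_add_cancel, hPn, ← neg_neg (n - 1)] at this
    · exact mem_Phi_applyMove c (adj 0).symm d
  by_cases h1 : m = P 1
  · subst h1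
    have had : a ≠ d := fun h => hmd.notMem_Phi (h ▸ ha')
    by_cases hbd : b = d
    · subst hbd
      have ready' : ∀ i, 2 ≤ i → i ≤ n → Ready G (applyMove c (P 1) b) (P i) 6 :=
        fun i h1 h2 => pres i 6 (by norm_num) (ne i 1 (by omega) (by omega))
      refine bobWins_of_even_path (p := P) (l := 2) (r := n) (by omega) (hn.sub_even even_two)
        adj (inj _ _ (by omega)) ready' hab.symm (mem_Phi_applyMove c (adj 1).symm b) ?_ ?_
      · rw [hPn]
        exact mono _ hb
      · rw [hPn]
        exact mono _ ha
    · obtain ⟨q, hq⟩ : ∃ q, ∀ x, x ≠ q → x = a ∨ x = b ∨ x = d := by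
        clear * - hab had hbd
        decide +revert
      refine bobWins_of_Phi_insert_eq_univ (pres 0 1 (by norm_num) (Ne.symm h0)) q fun x hx => ?_
      rcases hq x hx with rfl | rfl | rfl
      · exact mono _ ha
      · exact mono _ hb
      · exact mem_Phi_applyMove c (adj 0) _
  · have ready' : ∀ i, -1 ≤ i → i ≤ 0 → Ready G (applyMove c m d) (P (-i)) 6 := by
      intro i hi1 hi2
      refine pres (-i) 6 (by norm_num) ?_
      obtain rfl | rfl : i = -1 ∨ i = 0 := by omega
      · exact Ne.symm h1
      · exact Ne.symm h0
    exact bobWins_of_even_path (p := fun i => P (-i)) (l := -1) (r := 0) (by norm_num)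
      (by norm_num) adj_neg (inj_neg _ _ (by omega)) ready' hab (mono _ ha') (mono _ ha)
      (mono _ hb)

end Cycle


omit [DecidableEq V] in
/-- The vertices of a cycle form a periodic sequence, starting with any prescribed edge. -/
theorem exists_periodic_of_isCycle {G : SimpleGraph V} {x : V} {C : G.Walk x x}
    (hC : C.IsCycle) {u v : V} (huv : s(u, v) ∈ C.edges) :
    ∃ P : ℤ → V, (∀ i, G.Adj (P i) (P (i + 1))) ∧
      (∀ i j, P i = P j ↔ (C.length : ℤ) ∣ i - j) ∧ (∀ i, P i ∈ C.support) ∧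
      P 0 = u ∧ P 1 = v := by
  have h3 := hC.three_le_length
  set n : ℤ := (C.length : ℤ) with n_def
  have hn0 : 0 < n := by omega
  let Q : ℤ → V := fun i => C.getVert (i % n).toNat
  have Q_succ : ∀ i, Q (i + 1) = C.getVert ((i % n).toNat + 1) := by
    intro i
    have h1 := Int.emod_nonneg i hn0.ne'
    have h2 := Int.emod_lt_of_pos i hn0
    simp only [Q]
    rw [Int.add_emod, Int.emod_eq_of_lt (a := 1) (by norm_num) (by omega)]
    rcases (show i % n + 1 ≤ n by omega).eq_or_lt with h | h
    · rw [h, Int.emod_self, show (i % n).toNat + 1 = C.length by omega]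
      simp
    · rw [Int.emod_eq_of_lt (by omega) h]
      congr 1
      omega
  have Q_adj : ∀ i, G.Adj (Q i) (Q (i + 1)) := by
    intro i
    have h1 := Int.emod_nonneg i hn0.ne'
    have h2 := Int.emod_lt_of_pos i hn0
    have h := C.adj_getVert_succ (i := (i % n).toNat) (by omega)
    rwa [← Q_succ] at h
  have Q_periodic : ∀ i j, Q i = Q j ↔ n ∣ i - j := by
    intro i j
    have hi := Int.emod_nonneg i hn0.ne'
    have hi' := Int.emod_lt_of_pos i hn0
    have hj := Int.emod_nonneg j hn0.ne'
    have hj' := Int.emod_lt_of_pos j hn0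
    rw [Int.dvd_iff_emod_eq_zero, ← Int.emod_eq_emod_iff_emod_sub_eq_zero]
    constructor
    · intro h
      have := hC.getVert_injOn' (by rw [Set.mem_ofPred_eq]; omega)
        (by rw [Set.mem_ofPred_eq]; omega) h
      omega
    · intro h
      simp only [Q, h]
  have Q_mem : ∀ i, Q i ∈ C.support := fun i => C.getVert_mem_support _
  rw [← SimpleGraph.Walk.adj_toSubgraph_iff_mem_edges,
    SimpleGraph.Walk.toSubgraph_adj_iff] at huv
  obtain ⟨k, hk, hkn⟩ := huv
  have hmod : ((k : ℤ) % n).toNat = k := by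
    rw [Int.emod_eq_of_lt (by omega) (by omega), Int.toNat_natCast]
  have hQk : Q k = C.getVert k := by
    simp only [Q, hmod]
  have hQk' : Q (k + 1) = C.getVert (k + 1) := by
    rw [Q_succ, hmod]
  rw [← hQk, ← hQk', Sym2.eq_iff] at hk
  rcases hk with ⟨rfl, rfl⟩ | ⟨rfl, rfl⟩
  · refine ⟨fun i => Q (k + i), fun i => ?_, fun i j => ?_, fun i => Q_mem _, by simp, rfl⟩
    · simpa only [add_assoc] using Q_adj (k + i)
    · rw [Q_periodic, add_sub_add_left_eq_sub]
  · refine ⟨fun i => Q (k + 1 - i), fun i => ?_, fun i j => ?_, fun i => Q_mem _, by simp,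
      by simp⟩
    · have := Q_adj (k + 1 - (i + 1))
      rw [show k + 1 - (i + 1) + 1 = k + 1 - i by ring] at this
      exact this.symm
    · rw [Q_periodic, sub_sub_sub_cancel_left, dvd_sub_comm]

end GCN

open GCN in
/-- Winning cycle lemma.  With 4 colors (`Fin 4`), suppose the position `c` is a partial proper
coloring, Alice to move, and `G` contains an odd cycle all of whose vertices are uncolored and
have at least 8 uncolored pendant neighbors.  If the cycle has two adjacent vertices `u, v` and
there are distinct colors `a, b` with `{a, b} ⊆ Φ(u)` and `a ∈ Φ(v)`, then Bob wins. -/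
theorem statement6 {V : Type} [Fintype V] [DecidableEq V]
    (G : SimpleGraph V) [DecidableRel G.Adj]
    (c : V → Option (Fin 4)) (hc : ProperPartial G c)
    {x : V} (Cyc : G.Walk x x) (hCyc : Cyc.IsCycle) (hodd : Odd Cyc.length)
    (huncol : ∀ v ∈ Cyc.support, c v = none)
    (hleaves : ∀ v ∈ Cyc.support,
      8 ≤ {w : V | G.Adj v w ∧ G.degree w = 1 ∧ c w = none}.ncard)
    (u v : V) (huv : s(u, v) ∈ Cyc.edges)
    (a b : Fin 4) (hab : a ≠ b) (hu : {a, b} ⊆ Phi G c u) (hv : a ∈ Phi G c v) :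
    BobWins G .alice c := by
  obtain ⟨P, adj, periodic, mem, rfl, rfl⟩ := exists_periodic_of_isCycle hCyc huv
  refine bobWins_of_periodic (n := Cyc.length) (by exact_mod_cast hodd)
    (by exact_mod_cast hCyc.three_le_length) adj periodic (fun i => ⟨huncol _ (mem i), ?_⟩) hab
    (hu (by simp)) (hu (by simp)) hv
  refine (hleaves _ (mem i)).trans (Set.ncard_le_ncard ?_)
  rintro w ⟨h1, h2, h3⟩
  obtain ⟨y, -, hy⟩ := SimpleGraph.degree_eq_one_iff_existsUnique_adj.1 h2
  exact ⟨h1, fun z hz => (hy z hz).trans (hy _ h1.symm).symm, h3⟩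
end
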